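/- arXiv:2108.04850 — 2 statements merged into one kernel-verified Lean document; each statement's English description precedes it below -/
import Mathlib

section
/- For all integers m ≥ 4, n ≥ 0 and 1 ≤ k ≤ m−2, the wide melting lollipop graph WL_{m,n}^{(k)} — the labelled graph on {1,…,m+n} in which a pair {i,j} with i < j is an edge if and only if i ≥ w_j, where w_i = 1 for 1 ≤ i ≤ m−1, w_m = k+1, and w_i = i−2 for m+1 ≤ i ≤ m+n — is (e)-positive. -/
open scoped Classical
noncomputable section

/-- Words of length `d` in the positive integers. -/
abbrev NCWord (d : ℕ) := Fin d → ℕ+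

/-- `M_d`: coefficient functions of homogeneous degree-`d` series in
noncommuting variables. -/
abbrev Md (d : ℕ) := NCWord d → ℚ

/-- `Y_G`, the chromatic symmetric function of a labelled graph in
noncommuting variables, as an element of `M_d`. -/
def YG {d : ℕ} (G : SimpleGraph (Fin d)) : Md d :=
  fun w => if ∀ j k : Fin d, G.Adj j k → w j ≠ w k then 1 else 0

/-- Set partitions of `{0, …, d-1}`. -/
abbrev SetPtn (d : ℕ) := Finpartition (Finset.univ : Finset (Fin d))

/-- `j` and `k` lie in a common block of `π`. -/
def sameBlock {d : ℕ} (π : SetPtn d) (j k : Fin d) : Prop :=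
  ∃ B ∈ π.parts, j ∈ B ∧ k ∈ B

/-- The elementary symmetric function `e_π` in noncommuting variables. -/
def eSP {d : ℕ} (π : SetPtn d) : Md d :=
  fun w => if ∀ j k : Fin d, j ≠ k → sameBlock π j k → w j ≠ w k then 1 else 0

/-- The block of `π` containing `a`. -/
def blockOf {d : ℕ} (π : SetPtn d) (a : Fin d) : Finset (Fin d) :=
  Finset.univ.filter fun k => sameBlock π a k

/-- The type of a set partition relative to the distinguished element `a`:
the multiset of sizes of the blocks not containing `a` (an integer partition),
together with the size of the block containing `a`. -/
def ptype {d : ℕ} (π : SetPtn d) (a : Fin d) : Multiset ℕ × ℕ :=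
  ((π.parts.erase (blockOf π a)).val.map Finset.card, (blockOf π a).card)

/-- `K_d`: the span of the differences `e_{π₁} - e_{π₂}` over pairs of set
partitions of equal type (relative to the distinguished element `a`). -/
def Ksub {d : ℕ} (a : Fin d) : Submodule ℚ (Md d) :=
  Submodule.span ℚ
    {f | ∃ π₁ π₂ : SetPtn d, ptype π₁ a = ptype π₂ a ∧ f = eSP π₁ - eSP π₂}

/-- `(e)`-positivity of a labelled graph, with distinguished vertex `a`:
`Y_G` is congruent modulo `K_d` to a nonnegative combination of `e_π`'s. -/
def IsEPosNCAt {d : ℕ} (G : SimpleGraph (Fin d)) (a : Fin d) : Prop :=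
  ∃ (s : Finset (SetPtn d)) (c : SetPtn d → ℚ),
    (∀ π, 0 ≤ c π) ∧ YG G - ∑ π ∈ s, c π • eSP π ∈ Ksub a

/-- Induction `↑ : M_d → M_{d+1}`. -/
def induct {d : ℕ} (f : Md d) : Md (d + 1) :=
  fun w => if w (Fin.last d) = w ⟨d - 1, by omega⟩
    then f (fun t => w t.castSucc) else 0

/-- Concatenation of labelled graphs: identify the last vertex of `G` with
the first vertex of `H`. -/
def concatG {p q : ℕ} (G : SimpleGraph (Fin p)) (H : SimpleGraph (Fin q)) :
    SimpleGraph (Fin (p + q - 1)) :=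
  SimpleGraph.fromRel fun a b =>
    (∃ i j : Fin p, G.Adj i j ∧ (a : ℕ) = (i : ℕ) ∧ (b : ℕ) = (j : ℕ)) ∨
    (∃ i j : Fin q, H.Adj i j ∧ (a : ℕ) = (i : ℕ) + (p - 1) ∧ (b : ℕ) = (j : ℕ) + (p - 1))

/-- The reverse graph `G^r`. -/
def revG {d : ℕ} (G : SimpleGraph (Fin d)) : SimpleGraph (Fin d) :=
  SimpleGraph.comap (fun i : Fin d => (⟨d - 1 - (i : ℕ), by have := i.isLt; omega⟩ : Fin d)) G

/-- A labelled graph: a simple graph on vertex set `{0, …, n-1}`, `n ≥ 1`. -/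
structure LGraph where
  n : ℕ
  npos : 0 < n
  G : SimpleGraph (Fin n)

/-- The last vertex of a labelled graph. -/
def LGraph.last (A : LGraph) : Fin A.n := ⟨A.n - 1, by have := A.npos; omega⟩

/-- A labelled graph is `(e)`-positive (at its last vertex). -/
def LGraph.EPosNC (A : LGraph) : Prop := IsEPosNCAt A.G A.last

/-- Concatenation, as an operation on labelled graphs. -/
def LGraph.concat (A B : LGraph) : LGraph :=
  ⟨A.n + B.n - 1, by have := A.npos; have := B.npos; omega, concatG A.G B.G⟩

/-- Reversal, as an operation on labelled graphs. -/
def LGraph.rev (A : LGraph) : LGraph := ⟨A.n, A.npos, revG A.G⟩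

/-- Appendable `(e)`-positivity: `G + H` is `(e)`-positive for every
`(e)`-positive labelled graph `G`. -/
def LGraph.Appendable (H : LGraph) : Prop :=
  ∀ A : LGraph, A.EPosNC → (A.concat H).EPosNC

/-- The chromatic symmetric polynomial of `G` in `n` commuting variables. -/
def cspoly {V : Type} [Fintype V] [DecidableEq V] (G : SimpleGraph V) (n : ℕ) :
    MvPolynomial (Fin n) ℚ :=
  ∑ κ ∈ Finset.univ.filter (fun κ : V → Fin n => ∀ u v : V, G.Adj u v → κ u ≠ κ v),
    ∏ v : V, MvPolynomial.X (κ v)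

/-- `e`-positivity of a finite graph. -/
def EPos {V : Type} [Fintype V] [DecidableEq V] (G : SimpleGraph V) : Prop :=
  ∃ c : Nat.Partition (Fintype.card V) → ℚ, (∀ p, 0 ≤ c p) ∧
    ∀ n : ℕ, cspoly G n =
      ∑ p : Nat.Partition (Fintype.card V),
        c p • (p.parts.map fun r => MvPolynomial.esymm (Fin n) ℚ r).prod

/-- Closed neighbourhood of a vertex, as a finset. -/
def closedNbhd {d : ℕ} (G : SimpleGraph (Fin d)) (i : Fin d) : Finset (Fin d) :=
  Finset.univ.filter fun k => k = i ∨ G.Adj i k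

/-- `m_i`: the largest label in the closed neighbourhood of `i`. -/
def mIdx {d : ℕ} (G : SimpleGraph (Fin d)) (i : Fin d) : Fin d :=
  (closedNbhd G i).max' ⟨i, by simp [closedNbhd]⟩

/-- `w_i`: the smallest label in the closed neighbourhood of `i`. -/
def wIdx {d : ℕ} (G : SimpleGraph (Fin d)) (i : Fin d) : Fin d :=
  (closedNbhd G i).min' ⟨i, by simp [closedNbhd]⟩

/-- Labelled unit interval graph. -/
def IsUnitInterval {d : ℕ} (G : SimpleGraph (Fin d)) : Prop :=
  ∀ i v w j : Fin d, i ≤ v → v < w → w ≤ j → G.Adj i j → G.Adj v w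

/-- An acyclic orientation of a graph, as an asymmetric relation with
irreflexive transitive closure whose symmetrization matches adjacency. -/
def IsAcyclicOrientation {V : Type} (G : SimpleGraph V) (r : V → V → Prop) : Prop :=
  (∀ a b, r a b → ¬ r b a) ∧
  (∀ a b, a ≠ b → ((r a b ∨ r b a) ↔ G.Adj a b)) ∧
  Irreflexive (Relation.TransGen r)

/-- The set of sinks of an orientation. -/
def sinkSet {V : Type} [Fintype V] (r : V → V → Prop) : Finset V :=
  Finset.univ.filter fun x => ∀ y, ¬ r x y

/-- The labelled path `P_d`. -/
def PathG (d : ℕ) : SimpleGraph (Fin d) :=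
  SimpleGraph.fromRel fun a b => (b : ℕ) = (a : ℕ) + 1

/-- The labelled cycle `C_d`. -/
def CycleG (d : ℕ) : SimpleGraph (Fin d) :=
  SimpleGraph.fromRel fun a b => (b : ℕ) = (a : ℕ) + 1 ∨ ((a : ℕ) = 0 ∧ (b : ℕ) = d - 1)

/-- The wide melting lollipop graph `WL_{m,n}^{(k)}` (0-indexed labels):
`{a, b}` with `a < b` is an edge iff `w_b ≤ a`, where `w_b = 0` for
`b ≤ m - 2`, `w_{m-1} = k`, and `w_b = b - 2` for `b ≥ m`. -/
def WLgraph (m n k : ℕ) : SimpleGraph (Fin (m + n)) :=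
  SimpleGraph.fromRel fun a b => (a : ℕ) < (b : ℕ) ∧
    (if (b : ℕ) ≤ m - 2 then 0 else if (b : ℕ) = m - 1 then k else (b : ℕ) - 2) ≤ (a : ℕ)

/-! ### Elementary symmetric sums and the tail transfer -/

section Coloring

variable {ι A : Type} [CommRing A] (x : ι → A)

/-- The elementary symmetric sum of degree `k` in the variables `x i`, `i ∈ S`. -/
def elemSum (S : Finset ι) (k : ℕ) : A := ∑ t ∈ S.powersetCard k, ∏ i ∈ t, x i

@[simp] lemma elemSum_zero (S : Finset ι) : elemSum x S 0 = 1 := by simp [elemSum]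

variable [DecidableEq ι]

lemma elemSum_insert {S : Finset ι} {a : ι} (ha : a ∉ S) (k : ℕ) :
    elemSum x (insert a S) (k + 1) = elemSum x S (k + 1) + x a * elemSum x S k := by
  unfold elemSum
  rw [Finset.powersetCard_succ_insert ha, Finset.sum_union, Finset.sum_image, Finset.mul_sum]
  · congr 1
    refine Finset.sum_congr rfl fun t ht => ?_
    rw [Finset.prod_insert]
    exact fun h => ha ((Finset.mem_powersetCard.1 ht).1 h)
  · intro s hs t ht hst
    have h1 : a ∉ s := fun h => ha ((Finset.mem_powersetCard.1 hs).1 h)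
    have h2 : a ∉ t := fun h => ha ((Finset.mem_powersetCard.1 ht).1 h)
    rw [← Finset.erase_insert h1, hst, Finset.erase_insert h2]
  · rw [Finset.disjoint_left]
    intro s hs hs'
    obtain ⟨t, -, rfl⟩ := Finset.mem_image.1 hs'
    exact ha ((Finset.mem_powersetCard.1 hs).1 (Finset.mem_insert_self _ _))

lemma elemSum_erase {S : Finset ι} {a : ι} (ha : a ∈ S) (k : ℕ) :
    elemSum x S (k + 1) = elemSum x (S.erase a) (k + 1) + x a * elemSum x (S.erase a) k := by
  conv_lhs => rw [← Finset.insert_erase ha]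
  exact elemSum_insert x (Finset.notMem_erase a S) k

lemma sum_mul_elemSum_erase (S : Finset ι) (k : ℕ) :
    ∑ i ∈ S, x i * elemSum x (S.erase i) k = (k + 1 : ℕ) * elemSum x S (k + 1) := by
  induction S using Finset.induction_on generalizing k with
  | empty => simp [elemSum, Finset.powersetCard_eq_empty.2 (show (∅ : Finset ι).card < k + 1 by simp)]
  | insert a S ha ih =>
    rw [Finset.sum_insert ha, Finset.erase_insert ha, elemSum_insert x ha]
    have key : ∀ i ∈ S, (insert a S).erase i = insert a (S.erase i) := fun i hi => by
      rw [Finset.erase_insert_of_ne]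
      rintro rfl; exact ha hi
    cases k with
    | zero =>
      have h := ih 0
      simp only [elemSum_zero, mul_one] at h ⊢
      rw [h]; push_cast; ring
    | succ k =>
      have : ∑ i ∈ S, x i * elemSum x ((insert a S).erase i) (k + 1) =
          ∑ i ∈ S, x i * elemSum x (S.erase i) (k + 1) +
            x a * ∑ i ∈ S, x i * elemSum x (S.erase i) k := by
        rw [Finset.mul_sum, ← Finset.sum_add_distrib]
        refine Finset.sum_congr rfl fun i hi => ?_
        rw [key i hi, elemSum_insert x (fun h => ha (Finset.mem_of_mem_erase h))]
        ring
      rw [this, ih, ih]; push_cast; ring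

variable [Fintype ι]

/-- The elementary symmetric sum in all variables. -/
abbrev elemAll (k : ℕ) : A := elemSum x Finset.univ k

/-- The rooted clique on `p` vertices, without the weight of its root. -/
def rootedClique : ℕ → ι → A
  | 0, _ => 0
  | p + 1, i => elemSum x (Finset.univ.erase i) p

/-- Weighted colourings of `n` further vertices of a triangular ladder whose last two vertices
so far have colours `i` and `j`, with final colour `r`. -/
def ladderTail : ℕ → ι → ι → ι → A
  | 0, _, j, r => if r = j then 1 else 0
  | n + 1, i, j, r => ∑ l, if l ≠ i ∧ l ≠ j then x l * ladderTail n j l r else 0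

/-- The ladder on `n + 2` vertices, rooted at its end, with `α` and `β` glued to its first two
vertices. -/
def ladderGlue (n : ℕ) (α β : ι → A) (r : ι) : A :=
  ∑ i, ∑ j, if i ≠ j then x i * α i * (x j * β j) * ladderTail x n i j r else 0

/-- The ladder on `q` vertices, rooted at its end, with `α` glued to its first vertex. -/
def ladderAppend : ℕ → (ι → A) → ι → A
  | 0, _, _ => 0
  | 1, α, r => x r * α r
  | q + 2, α, r => ladderGlue x q α 1 r

/-- The clique on `p` vertices concatenated with the ladder on `q` vertices. -/
abbrev cliqueLadder (p q : ℕ) : ι → A := ladderAppend x q (rootedClique x p)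

/-- The clique on `m` vertices with a ladder of `n` further vertices starting at one of its
edges. -/
def cliqueTail (m n : ℕ) (r : ι) : A :=
  ∑ i, ∑ j, if i ≠ j then
    x i * x j * elemSum x ((Finset.univ.erase i).erase j) (m - 2) * ladderTail x n i j r else 0

lemma mul_rootedClique (p : ℕ) (i : ι) :
    x i * rootedClique x p i = elemAll x p - rootedClique x (p + 1) i := by
  cases p with
  | zero => simp [rootedClique]
  | succ p => simp [rootedClique, elemAll, elemSum_erase x (Finset.mem_univ i) p]

lemma rootedClique_one : rootedClique x 1 = 1 := by
  ext i; simp [rootedClique]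

lemma sum_mul_rootedClique (p : ℕ) : ∑ i, x i * rootedClique x p i = p * elemAll x p := by
  cases p with
  | zero => simp [rootedClique]
  | succ p => exact sum_mul_elemSum_erase x Finset.univ p

/-- Gluing two rooted cliques at their roots. -/
lemma rootedClique_mul (a b : ℕ) :
    rootedClique x (a + 1) * rootedClique x (b + 1) =
      ∑ k ∈ Finset.range (a + 1), (elemAll x k • rootedClique x (a + b + 1 - k) -
        elemAll x (a + b + 1 - k) • rootedClique x k) := by
  induction a generalizing b with
  | zero =>
    ext i
    simp [rootedClique]
  | succ a ih =>
    have h := ih (b + 1)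
    rw [Finset.sum_range_succ, show a + 1 + b + 1 = a + (b + 1) + 1 by ring, ← h]
    ext i
    simp only [Pi.mul_apply, Pi.add_apply, Pi.sub_apply, Pi.smul_apply, smul_eq_mul,
      show a + (b + 1) + 1 - (a + 1) = b + 1 by omega]
    linear_combination rootedClique x (b + 1) i * mul_rootedClique x (a + 1) i -
      rootedClique x (a + 1) i * mul_rootedClique x (b + 1) i

lemma sum_sum_ne_ne (f : ι → A) (h : ι → ι → A) :
    ∑ i, ∑ j, (if i ≠ j then f i * ∑ l, (if l ≠ i ∧ l ≠ j then h j l else 0) else 0) =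
      ∑ j, ∑ l, if j ≠ l then (∑ i, f i - f j - f l) * h j l else 0 := by
  rw [Finset.sum_comm]
  refine Finset.sum_congr rfl fun j _ => ?_
  have : ∀ i, (if i ≠ j then f i * ∑ l, (if l ≠ i ∧ l ≠ j then h j l else 0) else 0) =
      ∑ l, if j ≠ l then (if i ≠ j ∧ i ≠ l then f i else 0) * h j l else 0 := by
    intro i
    split_ifs with hi
    · rw [Finset.mul_sum]
      refine Finset.sum_congr rfl fun l _ => ?_
      by_cases h1 : l = i <;> by_cases h2 : l = j <;> simp_all [eq_comm]
    · symm; apply Finset.sum_eq_zero; intro l _; simp_all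
  rw [Finset.sum_congr rfl fun i _ => this i, Finset.sum_comm]
  refine Finset.sum_congr rfl fun l _ => ?_
  split_ifs with hjl
  · rw [← Finset.sum_mul]
    congr 1
    rw [← Finset.sum_filter]
    have : (Finset.univ.filter fun i => i ≠ j ∧ i ≠ l) = (Finset.univ.erase j).erase l := by
      ext i; simp [and_comm]
    rw [this, Finset.sum_erase_eq_sub (by simp [hjl.symm]), Finset.sum_erase_eq_sub (by simp)]
  · simp

lemma ladderGlue_add_left (n : ℕ) (α α' β : ι → A) :
    ladderGlue x n (α + α') β = ladderGlue x n α β + ladderGlue x n α' β := by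
  ext r
  simp only [ladderGlue, Pi.add_apply, ← Finset.sum_add_distrib]
  refine Finset.sum_congr rfl fun i _ => Finset.sum_congr rfl fun j _ => ?_
  split_ifs <;> ring

lemma ladderGlue_smul_left (n : ℕ) (c : A) (α β : ι → A) :
    ladderGlue x n (c • α) β = c • ladderGlue x n α β := by
  ext r
  simp only [ladderGlue, Pi.smul_apply, smul_eq_mul, Finset.mul_sum]
  refine Finset.sum_congr rfl fun i _ => Finset.sum_congr rfl fun j _ => ?_
  split_ifs <;> ring

/-- Appending a ladder, as a linear map. -/
def ladderAppendHom (q : ℕ) : (ι → A) →ₗ[A] (ι → A) where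
  toFun := ladderAppend x q
  map_add' α α' := by
    match q with
    | 0 => ext; simp [ladderAppend]
    | 1 => ext; simp [ladderAppend, mul_add]
    | q + 2 => exact ladderGlue_add_left x q α α' 1
  map_smul' c α := by
    match q with
    | 0 => ext; simp [ladderAppend]
    | 1 => ext; simp [ladderAppend, mul_left_comm]
    | q + 2 => exact ladderGlue_smul_left x q c α 1

/-- Detaching the first vertex of a ladder. -/
lemma ladderGlue_succ (n a : ℕ) (β : ι → A) :
    ladderGlue x (n + 1) (rootedClique x a) β =
      ((a : A) - 2) • elemAll x a • ladderAppend x (n + 2) β +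
        ladderAppend x (n + 2) (rootedClique x (a + 1) * β) +
        ladderGlue x n β (rootedClique x (a + 1)) := by
  ext r
  have h1 : ladderGlue x (n + 1) (rootedClique x a) β r = ∑ i, ∑ j, (if i ≠ j then
      (x i * rootedClique x a i) * ∑ l, (if l ≠ i ∧ l ≠ j then
        (x j * β j) * (x l * ladderTail x n j l r) else 0) else 0) := by
    simp only [ladderGlue, ladderTail]
    refine Finset.sum_congr rfl fun i _ => Finset.sum_congr rfl fun j _ => ?_
    split_ifs with hij
    · rw [mul_assoc, Finset.mul_sum]
      congr 1
      refine Finset.sum_congr rfl fun l _ => ?_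
      split_ifs <;> ring
    · rfl
  rw [h1, sum_sum_ne_ne (fun i => x i * rootedClique x a i)
    (fun j l => (x j * β j) * (x l * ladderTail x n j l r)), sum_mul_rootedClique]
  simp only [Pi.add_apply, Pi.smul_apply, smul_eq_mul, ladderAppend, ladderGlue, Finset.mul_sum,
    ← Finset.sum_add_distrib]
  refine Finset.sum_congr rfl fun i _ => Finset.sum_congr rfl fun j _ => ?_
  split_ifs with hij
  · rw [mul_rootedClique, mul_rootedClique]
    simp only [Pi.mul_apply, Pi.one_apply]
    ring
  · simp

lemma ladderGlue_zero (a : ℕ) (β : ι → A) :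
    ladderGlue x 0 (rootedClique x a) β =
      ((a : A) - 2) • elemAll x a • ladderAppend x 1 β +
        ladderAppend x 1 (rootedClique x (a + 1) * β) + elemAll x a • ladderAppend x 1 β := by
  ext r
  have h : ladderGlue x 0 (rootedClique x a) β r =
      (∑ i ∈ Finset.univ.erase r, x i * rootedClique x a i) * (x r * β r) := by
    rw [ladderGlue, Finset.sum_mul]
    refine (Finset.sum_erase (a := r) _ ?_).symm.trans ?_
    rotate_left
    · refine Finset.sum_congr rfl fun i hi => ?_
      rw [Finset.sum_eq_single r]
      · simp [ladderTail, Finset.ne_of_mem_erase hi]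
      · intro j _ hj; simp [ladderTail, hj.symm]
      · simp
    · apply Finset.sum_eq_zero
      intro j _
      by_cases hj : r = j <;> simp [ladderTail, hj]
  rw [h, Finset.sum_erase_eq_sub (Finset.mem_univ r), sum_mul_rootedClique, mul_rootedClique]
  simp only [Pi.add_apply, Pi.smul_apply, smul_eq_mul, ladderAppend, Pi.mul_apply]
  ring

lemma cliqueTail_zero (m : ℕ) : cliqueTail x (m + 2) 0 = (m + 1) • cliqueLadder x (m + 2) 1 := by
  ext r
  have h : cliqueTail x (m + 2) 0 r =
      x r * ∑ i ∈ Finset.univ.erase r, x i * elemSum x ((Finset.univ.erase r).erase i) m := by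
    rw [cliqueTail, Finset.mul_sum]
    refine (Finset.sum_erase (a := r) _ ?_).symm.trans ?_
    rotate_left
    · refine Finset.sum_congr rfl fun i hi => ?_
      rw [Finset.sum_eq_single r]
      · simp [ladderTail, Finset.ne_of_mem_erase hi, Finset.erase_right_comm]; ring
      · intro j _ hj; simp [ladderTail, hj.symm]
      · simp
    · apply Finset.sum_eq_zero
      intro j _
      by_cases hj : r = j <;> simp [ladderTail, hj]
  rw [h, sum_mul_elemSum_erase]
  simp [cliqueLadder, ladderAppend, rootedClique]
  ring

lemma cliqueTail_succ (m n : ℕ) : cliqueTail x (m + 2) (n + 1) =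
    cliqueTail x (m + 3) n + m • cliqueLadder x (m + 2) (n + 2) := by
  ext r
  have h1 : ∀ j l, j ≠ l → ∑ i ∈ (Finset.univ.erase j).erase l,
      x i * elemSum x ((Finset.univ.erase i).erase j) m =
      elemSum x ((Finset.univ.erase j).erase l) (m + 1) + m * rootedClique x (m + 2) j := by
    intro j l hjl
    have hl : l ∈ Finset.univ.erase j := by simp [hjl.symm]
    rw [rootedClique, elemSum_erase x hl]
    set S := (Finset.univ.erase j).erase l with hS
    have h2 : ∀ i ∈ S, (Finset.univ.erase i).erase j = insert l (S.erase i) := by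
      intro i hi; ext y; simp only [hS, Finset.mem_erase, Finset.mem_univ, Finset.mem_insert] at *
      grind
    have h3 : ∀ i, l ∉ S.erase i := by simp [hS]
    cases m with
    | zero =>
      have := sum_mul_elemSum_erase x S 0
      simp only [elemSum_zero] at this ⊢
      rw [this]; simp
    | succ m =>
      rw [Finset.sum_congr rfl fun i hi => by rw [h2 i hi, elemSum_insert x (h3 i), mul_add,
        mul_left_comm], Finset.sum_add_distrib, ← Finset.mul_sum, sum_mul_elemSum_erase,
        sum_mul_elemSum_erase]
      push_cast; ring
  simp only [cliqueTail, Pi.add_apply, Pi.smul_apply, cliqueLadder, ladderAppend, ladderGlue,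
    Finset.smul_sum, ← Finset.sum_add_distrib, ladderTail]
  have h4 : ∀ i j : ι, (if i ≠ j then x i * x j * elemSum x ((Finset.univ.erase i).erase j)
      (m + 2 - 2) * ∑ l, (if l ≠ i ∧ l ≠ j then x l * ladderTail x n j l r else 0) else 0) =
      ∑ l, if j ≠ l then (if i ∈ (Finset.univ.erase j).erase l then
        x i * elemSum x ((Finset.univ.erase i).erase j) m else 0) *
          (x j * x l * ladderTail x n j l r) else 0 := by
    intro i j
    split_ifs with hij
    · rw [Finset.mul_sum]
      refine Finset.sum_congr rfl fun l _ => ?_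
      by_cases h1 : l = i
      · simp_all
      · by_cases h2 : l = j
        · simp_all
        · have h5 : i ≠ l := fun h => h1 h.symm
          have h6 : j ≠ l := fun h => h2 h.symm
          simp [h1, h2, h5, h6, hij]; ring
    · symm; apply Finset.sum_eq_zero; intro l _; simp_all
  rw [Finset.sum_comm]
  refine Finset.sum_congr rfl fun j _ => ?_
  rw [Finset.sum_congr rfl fun i _ => h4 i j, Finset.sum_comm]
  refine Finset.sum_congr rfl fun l _ => ?_
  split_ifs with hjl
  · rw [← Finset.sum_mul, ← Finset.sum_filter, Finset.filter_mem_eq_inter, Finset.univ_inter,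
      h1 j l hjl]
    simp
    ring
  · simp

lemma cliqueLadder_one (n : ℕ) : cliqueLadder x 1 (n + 2) = cliqueTail x 2 n := by
  ext r
  simp [cliqueLadder, ladderAppend, ladderGlue, cliqueTail, rootedClique]

end Coloring

/-! ### The cone spanned by rooted products of cliques -/

section Cone

variable {ι A : Type} [CommRing A] (x : ι → A) [DecidableEq ι] [Fintype ι]

/-- The cone of degree `N` generated by products of elementary symmetric sums with one rooted
clique. -/
inductive CliqueCone : ℕ → (ι → A) → Prop
  | zero (N : ℕ) : CliqueCone N 0
  | add {N : ℕ} {g h : ι → A} : CliqueCone N g → CliqueCone N h → CliqueCone N (g + h)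
  | clique (b : ℕ) : CliqueCone (b + 1) (cliqueLadder x (b + 1) 1)
  | elem_smul {N : ℕ} {g : ι → A} (k : ℕ) : CliqueCone N g → CliqueCone (N + k) (elemAll x k • g)

variable {x}

lemma CliqueCone.sum {N : ℕ} {κ : Type} (s : Finset κ) (g : κ → ι → A)
    (h : ∀ k ∈ s, CliqueCone x N (g k)) : CliqueCone x N (∑ k ∈ s, g k) := by
  induction s using Finset.induction_on with
  | empty => simpa using CliqueCone.zero N
  | insert a s ha ih =>
    rw [Finset.sum_insert ha]
    exact (h a (by simp)).add (ih fun k hk => h k (by simp [hk]))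

lemma CliqueCone.nsmul {N : ℕ} {g : ι → A} (n : ℕ) (h : CliqueCone x N g) :
    CliqueCone x N (n • g) := by
  simpa using CliqueCone.sum (Finset.range n) (fun _ => g) fun _ _ => h

lemma CliqueCone.elem_smul' {N M : ℕ} {g : ι → A} (k : ℕ) (h : CliqueCone x N g)
    (hM : M = N + k) : CliqueCone x M (elemAll x k • g) := hM ▸ h.elem_smul k

variable (x)

@[simp] lemma cliqueLadder_zero_left (q : ℕ) : cliqueLadder x 0 q = 0 :=
  (ladderAppendHom x q).map_zero

@[simp] lemma cliqueLadder_zero_right (p : ℕ) : cliqueLadder x p 0 = 0 := rfl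

/-- Sizes of the two cliques that alternate while a ladder is detached vertex by vertex from a
clique of size `p`. -/
def altSize (p i : ℕ) : ℕ := if Even i then p + i / 2 else i / 2 + 1

lemma altSize_even (p j : ℕ) : altSize p (2 * j) = p + j := by simp [altSize]

lemma altSize_odd (p j : ℕ) : altSize p (2 * j + 1) = j + 1 := by
  simp [altSize]; omega

lemma altSize_add_two (p i : ℕ) : altSize p (i + 2) = altSize p i + 1 := by
  obtain ⟨j, rfl | rfl⟩ := Nat.even_or_odd' i
  · rw [show 2 * j + 2 = 2 * (j + 1) by ring, altSize_even, altSize_even]; ring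
  · rw [show 2 * j + 1 + 2 = 2 * (j + 1) + 1 by ring, altSize_odd, altSize_odd]

/-- The contribution of one detached vertex. -/
def detachTerm (p t r : ℕ) : ι → A :=
  ((altSize p t : A) - 2) • elemAll x (altSize p t) • cliqueLadder x (altSize p (t + 1)) r +
    ladderAppend x r (rootedClique x (altSize p t + 1) * rootedClique x (altSize p (t + 1)))

lemma ladderGlue_eq_sum (p Q t : ℕ) :
    ladderGlue x Q (rootedClique x (altSize p t)) (rootedClique x (altSize p (t + 1))) =
      ∑ u ∈ Finset.range (Q + 1), detachTerm x p (t + u) (Q + 1 - u) +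
        elemAll x (altSize p (t + Q)) • cliqueLadder x (altSize p (t + Q + 1)) 1 := by
  induction Q generalizing t with
  | zero => simp [ladderGlue_zero, detachTerm]
  | succ Q ih =>
    rw [ladderGlue_succ, ← altSize_add_two, ih (t + 1), Finset.sum_range_succ' _ (Q + 1)]
    have h : ∀ u, detachTerm x p (t + (u + 1)) (Q + 1 + 1 - (u + 1)) =
        detachTerm x p (t + 1 + u) (Q + 1 - u) := fun u => by
      rw [Nat.add_sub_add_right, add_assoc, add_comm 1 u]
    rw [Finset.sum_congr rfl fun u _ => h u, detachTerm, altSize_add_two, add_assoc t 1 Q,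
      add_comm 1 Q]
    simp only [add_zero, Nat.sub_zero]
    abel

lemma cliqueLadder_eq_sum (p Q : ℕ) :
    cliqueLadder x p (Q + 2) = ∑ t ∈ Finset.range (Q + 1), detachTerm x p t (Q + 1 - t) +
      elemAll x (altSize p Q) • cliqueLadder x (altSize p (Q + 1)) 1 := by
  have h := ladderGlue_eq_sum x p Q 0
  rw [show altSize p 0 = p by simp [altSize], show altSize p (0 + 1) = 1 by simp [altSize],
    rootedClique_one] at h
  simp only [zero_add] at h
  exact h

lemma ladderAppend_rootedClique_mul (a b r : ℕ) :
    ladderAppend x r (rootedClique x (a + 1) * rootedClique x (b + 1)) =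
      ∑ k ∈ Finset.range (a + 1), (elemAll x k • cliqueLadder x (a + b + 1 - k) r -
        elemAll x (a + b + 1 - k) • cliqueLadder x k r) := by
  rw [rootedClique_mul]
  change ladderAppendHom x r _ = _
  rw [map_sum]
  refine Finset.sum_congr rfl fun k _ => ?_
  rw [map_sub, map_smul, map_smul]
  rfl

lemma ladderAppend_altSize (p t r : ℕ) :
    ladderAppend x r
        (rootedClique x (altSize (p + 1) t + 1) * rootedClique x (altSize (p + 1) (t + 1))) =
      cliqueLadder x (p + 1 + t + 1) r + ∑ k ∈ Finset.range ((t + 1) / 2),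
        (elemAll x (k + 1) • cliqueLadder x (p + 1 + t - k) r -
          elemAll x (p + 1 + t - k) • cliqueLadder x (k + 1) r) := by
  have key : ∀ a b, a = (t + 1) / 2 → a + b = p + 1 + t →
      ladderAppend x r (rootedClique x (a + 1) * rootedClique x (b + 1)) =
      cliqueLadder x (p + 1 + t + 1) r + ∑ k ∈ Finset.range ((t + 1) / 2),
        (elemAll x (k + 1) • cliqueLadder x (p + 1 + t - k) r -
          elemAll x (p + 1 + t - k) • cliqueLadder x (k + 1) r) := by
    intro a b ha hab
    rw [ladderAppend_rootedClique_mul, Finset.sum_range_succ', hab, ← ha, add_comm]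
    simp [elemAll]
  obtain ⟨j, rfl | rfl⟩ := Nat.even_or_odd' t
  · rw [altSize_even, altSize_odd, mul_comm]
    exact key j (p + 1 + j) (by omega) (by omega)
  · have h : altSize (p + 1) (2 * j + 1 + 1) = p + (j + 1) + 1 := by
      rw [show 2 * j + 1 + 1 = 2 * (j + 1) by ring, altSize_even]; ring
    rw [altSize_odd, h]
    exact key (j + 1) (p + (j + 1)) (by omega) (by omega)

/-- The part of a clique with a ladder that compensates negative contributions; the clique has
`p + 2` vertices. -/
def ladderCore (p q R : ℕ) : ι → A :=
  ∑ j ∈ Finset.range R, (p + j) • elemAll x (p + 2 + j) • cliqueLadder x (j + 1) (q - 2 * j - 1)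

lemma sum_range_of_vanish {M : Type} [AddCommMonoid M] (F : ℕ → M) {a b : ℕ}
    (ha : ∀ t, a ≤ t → F t = 0) (hab : a ≤ b) :
    ∑ t ∈ Finset.range b, F t = ∑ t ∈ Finset.range a, F t := by
  symm
  apply Finset.sum_subset
  · simpa using hab
  · intro t _ ht; exact ha t (by simpa using ht)

lemma sum_range_two_mul {M : Type} [AddCommMonoid M] (F : ℕ → M) (n : ℕ) :
    ∑ t ∈ Finset.range (2 * n), F t = ∑ j ∈ Finset.range n, (F (2 * j) + F (2 * j + 1)) := by
  induction n with
  | zero => simp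
  | succ n ih =>
    rw [show 2 * (n + 1) = 2 * n + 1 + 1 by ring, Finset.sum_range_succ, Finset.sum_range_succ, ih,
      Finset.sum_range_succ, add_assoc]

lemma sum_range_even {M : Type} [AddCommMonoid M] (F : ℕ → M) {n : ℕ}
    (hF : ∀ t, n ≤ t → F t = 0) :
    ∑ t ∈ Finset.range n, (if Even t then F t else 0) = ∑ j ∈ Finset.range n, F (2 * j) := by
  rw [← sum_range_of_vanish (b := 2 * n) _ _ (by omega), sum_range_two_mul]
  · simp
  · intro t ht; simp [hF t ht]

lemma sum_range_shift {M : Type} [AddCommMonoid M] (F : ℕ → M) {n : ℕ} (m : ℕ)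
    (hF : ∀ t, n ≤ t → F t = 0) :
    ∑ t ∈ Finset.range n, (if m ≤ t then F t else 0) = ∑ t ∈ Finset.range n, F (m + t) := by
  rw [← sum_range_of_vanish (b := m + n) _ _ (by omega), Finset.sum_range_add]
  · rw [Finset.sum_eq_zero, zero_add]
    · simp
    · intro t ht; simp only [Finset.mem_range] at ht; simp; omega
  · intro t ht; simp [hF t ht]

lemma sum_sum_triangle {M : Type} [AddCommMonoid M] (h : ℕ → ℕ → M) {n : ℕ}
    (hh : ∀ k t, n ≤ t → h k t = 0) :
    ∑ t ∈ Finset.range n, ∑ k ∈ Finset.range ((t + 1) / 2), h k t =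
      ∑ t ∈ Finset.range n, ∑ k ∈ Finset.range n, h k (2 * k + 1 + t) := by
  have h1 : ∀ t ∈ Finset.range n, ∑ k ∈ Finset.range ((t + 1) / 2), h k t =
      ∑ k ∈ Finset.range n, if 2 * k + 1 ≤ t then h k t else 0 := by
    intro t ht
    rw [Finset.mem_range] at ht
    rw [← Finset.sum_filter]
    refine Finset.sum_congr ?_ fun _ _ => rfl
    ext k; simp only [Finset.mem_range, Finset.mem_filter]; omega
  rw [Finset.sum_congr rfl h1, Finset.sum_comm]
  conv_rhs => rw [Finset.sum_comm]
  exact Finset.sum_congr rfl fun k _ => sum_range_shift (h k) _ (hh k)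

lemma ladderCore_range (p q : ℕ) {R : ℕ} (hR : q ≤ R) :
    ladderCore x p q R = ladderCore x p q q := by
  refine sum_range_of_vanish _ (fun j hj => ?_) hR
  rw [show q - 2 * j - 1 = 0 by omega]; simp

/-- The terms of a detached vertex, sorted by sign. -/
lemma cliqueCone_detachTerm (p Q t N : ℕ) (hN : N = p + 2 + Q + 1) (ht : t ≤ Q)
    (hpos : ∀ k r, r ≤ Q + 1 → 1 ≤ k → CliqueCone x (k + r - 1) (cliqueLadder x k r)) :
    CliqueCone x N (detachTerm x (p + 2) t (Q + 1 - t)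
      - (if Even t then (p + t / 2) • elemAll x (p + 2 + t / 2) •
          cliqueLadder x (t / 2 + 1) (Q + 1 - t) else 0)
      - cliqueLadder x (p + 2 + t + 1) (Q + 1 - t)
      + ∑ k ∈ Finset.range ((t + 1) / 2),
          elemAll x (p + 2 + t - k) • cliqueLadder x (k + 1) (Q + 1 - t)) := by
  have hP : ∀ k < (t + 1) / 2, CliqueCone x N
      (elemAll x (k + 1) • cliqueLadder x (p + 2 + t - k) (Q + 1 - t)) := fun k hk =>
    (hpos _ _ (by omega) (by omega)).elem_smul' _ (by omega)
  rw [detachTerm, ladderAppend_altSize, Finset.sum_sub_distrib]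
  obtain ⟨j, rfl | rfl⟩ := Nat.even_or_odd' t
  · rw [altSize_odd, altSize_even]
    have h0 := CliqueCone.sum (Finset.range ((2 * j + 1) / 2))
      (fun k => elemAll x (k + 1) • cliqueLadder x (p + 2 + 2 * j - k) (Q + 1 - 2 * j))
      fun k hk => hP k (by simpa using hk)
    convert h0 using 1
    simp only [even_two, Even.mul_right, if_true, show 2 * j / 2 = j by omega]
    rw [show ((p + 2 + j : ℕ) : A) - 2 = ((p + j : ℕ) : A) by push_cast; ring, Nat.cast_smul_eq_nsmul]
    rw [show p + 1 + 1 = p + 2 by ring]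
    abel
  · rw [altSize_odd, show 2 * j + 1 + 1 = 2 * (j + 1) by ring, altSize_even]
    have hj := hP j (by omega)
    have h0 := (CliqueCone.sum (Finset.range j)
      (fun k => elemAll x (k + 1) • cliqueLadder x (p + 2 + (2 * j + 1) - k) (Q + 1 - (2 * j + 1)))
      fun k hk => hP k (by have := Finset.mem_range.1 hk; omega)).add (hj.nsmul j)
    convert h0 using 1
    have h1 : (2 * (j + 1)) / 2 = j + 1 := by omega
    simp only [h1, Finset.sum_range_succ]
    rw [show p + 2 + (2 * j + 1) - j = p + 2 + (j + 1) by omega,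
      if_neg (by simp), ← Nat.cast_smul_eq_nsmul A j]
    simp only [show p + 1 + 1 = p + 2 by ring]
    push_cast
    module

/-- Induction step for the compensated positivity of a clique with a ladder. -/
lemma cliqueCone_sub_ladderCore (p Q : ℕ)
    (hpos : ∀ k r, r ≤ Q + 1 → 1 ≤ k → CliqueCone x (k + r - 1) (cliqueLadder x k r))
    (hcore : ∀ p' r, 1 ≤ r → r ≤ Q + 1 →
      CliqueCone x (p' + 2 + r - 1) (cliqueLadder x (p' + 2) r - ladderCore x p' r r)) :
    CliqueCone x (p + 2 + Q + 1)
      (cliqueLadder x (p + 2) (Q + 2) - ladderCore x p (Q + 2) (Q + 2)) := by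
  set N := p + 2 + Q + 1 with hN
  set h : ℕ → ℕ → ι → A := fun k t =>
    elemAll x (p + 2 + t - k) • cliqueLadder x (k + 1) (Q + 1 - t) with hh
  have hh0 : ∀ k t, Q + 1 ≤ t → h k t = 0 := fun k t ht => by
    simp only [hh, show Q + 1 - t = 0 by omega]; simp
  have hD : ladderCore x p (Q + 2) (Q + 2) = ∑ t ∈ Finset.range (Q + 1),
      if Even t then (p + t / 2) • elemAll x (p + 2 + t / 2) •
          cliqueLadder x (t / 2 + 1) (Q + 1 - t) else 0 := by
    rw [sum_range_even (n := Q + 1) (fun t => (p + t / 2) • elemAll x (p + 2 + t / 2) •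
      cliqueLadder x (t / 2 + 1) (Q + 1 - t)), ladderCore, Finset.sum_range_succ,
      show Q + 2 - 2 * (Q + 1) - 1 = 0 by omega]
    · simp only [cliqueLadder_zero_right, smul_zero, add_zero]
      refine Finset.sum_congr rfl fun j _ => ?_
      rw [show 2 * j / 2 = j by omega, show Q + 2 - 2 * j - 1 = Q + 1 - 2 * j by omega]
    · intro t ht; rw [show Q + 1 - t = 0 by omega]; simp
  have hneg : ∑ t ∈ Finset.range (Q + 1), ladderCore x (p + t + 1) (Q + 1 - t) (Q + 1 - t) =
      ∑ t ∈ Finset.range (Q + 1), ∑ k ∈ Finset.range (Q + 1), (p + t + k) • h k (2 * k + 1 + t) +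
        ∑ t ∈ Finset.range (Q + 1), ∑ k ∈ Finset.range ((t + 1) / 2), h k t := by
    rw [sum_sum_triangle h hh0]
    simp only [← Finset.sum_add_distrib]
    refine Finset.sum_congr rfl fun t _ => ?_
    rw [← ladderCore_range x _ _ (show Q + 1 - t ≤ Q + 1 by omega), ladderCore]
    refine Finset.sum_congr rfl fun k _ => ?_
    simp only [hh]
    rw [show p + t + 1 + k = p + t + k + 1 by ring, succ_nsmul,
      show p + 2 + (2 * k + 1 + t) - k = p + t + 1 + 2 + k by omega,
      show Q + 1 - (2 * k + 1 + t) = Q + 1 - t - 2 * k - 1 by omega]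
  have hpart : CliqueCone x N (∑ t ∈ Finset.range (Q + 1), (detachTerm x (p + 2) t (Q + 1 - t)
      - (if Even t then (p + t / 2) • elemAll x (p + 2 + t / 2) •
          cliqueLadder x (t / 2 + 1) (Q + 1 - t) else 0)
      - cliqueLadder x (p + 2 + t + 1) (Q + 1 - t)
      + ∑ k ∈ Finset.range ((t + 1) / 2), h k t)) :=
    CliqueCone.sum _ _ fun t ht => cliqueCone_detachTerm x p Q t N hN
      (by have := Finset.mem_range.1 ht; omega) hpos
  have hroot : CliqueCone x N (∑ t ∈ Finset.range (Q + 1),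
      (cliqueLadder x (p + 2 + t + 1) (Q + 1 - t)
        - ladderCore x (p + t + 1) (Q + 1 - t) (Q + 1 - t))) :=
    CliqueCone.sum _ _ fun t ht => by
      have ht := Finset.mem_range.1 ht
      have := hcore (p + t + 1) (Q + 1 - t) (by omega) (by omega)
      rwa [show p + t + 1 + 2 + (Q + 1 - t) - 1 = N by omega,
        show p + t + 1 + 2 = p + 2 + t + 1 by ring] at this
  have hrest : CliqueCone x N (∑ t ∈ Finset.range (Q + 1), ∑ k ∈ Finset.range (Q + 1),
      (p + t + k) • h k (2 * k + 1 + t)) := by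
    refine CliqueCone.sum _ _ fun t _ => CliqueCone.sum _ _ fun k _ => CliqueCone.nsmul _ ?_
    rcases Nat.lt_or_ge (2 * k + 1 + t) (Q + 1) with hlt | hge
    · exact (hpos _ _ (by omega) (by omega)).elem_smul' _ (by omega)
    · rw [hh0 _ _ hge]; exact .zero _
  have hlast : CliqueCone x N
      (elemAll x (altSize (p + 2) Q) • cliqueLadder x (altSize (p + 2) (Q + 1)) 1) := by
    obtain ⟨j, rfl | rfl⟩ := Nat.even_or_odd' Q
    · rw [altSize_even, altSize_odd]
      exact (hpos _ _ (by omega) (by omega)).elem_smul' _ (by omega)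
    · rw [altSize_odd, show 2 * j + 1 + 1 = 2 * (j + 1) by ring, altSize_even]
      exact (hpos _ _ (by omega) (by omega)).elem_smul' _ (by omega)
  convert ((hpart.add hroot).add hrest).add hlast using 1
  rw [cliqueLadder_eq_sum, hD]
  simp only [Finset.sum_add_distrib, Finset.sum_sub_distrib, hneg]
  abel

lemma cliqueCone_cliqueTail (m n : ℕ)
    (hpos : ∀ k r, r ≤ n + 1 → 3 ≤ k → CliqueCone x (k + r - 1) (cliqueLadder x k r)) :
    CliqueCone x (m + 2 + n) (cliqueTail x (m + 2) n) := by
  induction n generalizing m with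
  | zero =>
    rw [cliqueTail_zero]
    exact (CliqueCone.clique (m + 1)).nsmul _
  | succ n ih =>
    rw [cliqueTail_succ]
    refine CliqueCone.add ?_ ?_
    · have := ih (m + 1) fun k r hr hk => hpos k r (by omega) hk
      rwa [show m + 1 + 2 + n = m + 2 + (n + 1) by ring] at this
    · rcases Nat.eq_zero_or_pos m with rfl | hm
      · rw [zero_smul]; exact .zero _
      · have := hpos (m + 2) (n + 2) (by omega) (by omega)
        exact this.nsmul m

/-- A clique with a ladder lies in the cone. -/
theorem cliqueCone_cliqueLadder (q : ℕ) :
    (∀ k, 1 ≤ k → CliqueCone x (k + q - 1) (cliqueLadder x k q)) ∧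
    (1 ≤ q → ∀ p, CliqueCone x (p + 2 + q - 1) (cliqueLadder x (p + 2) q - ladderCore x p q q)) := by
  induction q using Nat.strong_induction_on with
  | _ q ih =>
  match q, ih with
  | 0, _ => exact ⟨fun k _ => .zero _, fun h => absurd h (by omega)⟩
  | 1, _ =>
    have h1 : ∀ k, 1 ≤ k → CliqueCone x (k + 1 - 1) (cliqueLadder x k 1) := fun k hk => by
      obtain ⟨k, rfl⟩ := Nat.exists_eq_add_of_le' hk
      exact .clique k
    refine ⟨h1, fun _ p => ?_⟩
    rw [ladderCore, Finset.sum_range_one]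
    simpa using h1 (p + 2) (by omega)
  | Q + 2, ih =>
    have hcore : ∀ p, CliqueCone x (p + 2 + (Q + 2) - 1)
        (cliqueLadder x (p + 2) (Q + 2) - ladderCore x p (Q + 2) (Q + 2)) := fun p =>
      cliqueCone_sub_ladderCore x p Q (fun k r hr hk => (ih r (by omega)).1 k hk)
        fun p' r hr hr' => (ih r (by omega)).2 hr p'
    have hpos2 : ∀ p, CliqueCone x (p + 2 + (Q + 2) - 1) (cliqueLadder x (p + 2) (Q + 2)) := by
      intro p
      rw [← sub_add_cancel (cliqueLadder x (p + 2) (Q + 2)) (ladderCore x p (Q + 2) (Q + 2))]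
      refine (hcore p).add (CliqueCone.sum _ _ fun j _ => CliqueCone.nsmul _ ?_)
      rcases Nat.lt_or_ge (2 * j + 1) (Q + 2) with hj | hj
      · exact ((ih (Q + 2 - 2 * j - 1) (by omega)).1 (j + 1) (by omega)).elem_smul' _ (by omega)
      · rw [show Q + 2 - 2 * j - 1 = 0 by omega, cliqueLadder_zero_right, smul_zero]
        exact .zero _
    refine ⟨fun k hk => ?_, fun _ => hcore⟩
    match k, hk with
    | 1, _ =>
      rw [cliqueLadder_one]
      have := cliqueCone_cliqueTail x 0 Q fun k r hr hk =>
        (ih r (by omega)).1 k (by omega)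
      rwa [show 0 + 2 + Q = 1 + (Q + 2) - 1 by omega] at this
    | p + 2, _ => exact hpos2 p

end Cone

/-! ### Colourings of the wide melting lollipop -/

section Melting

variable {ι A : Type} [CommRing A] (x : ι → A)

lemma prod_snoc (n : ℕ) (c : Fin n → ι) (l : ι) :
    ∏ v, x ((Fin.snoc c l : Fin (n + 1) → ι) v) = (∏ v, x (c v)) * x l := by
  simp [Fin.prod_univ_castSucc]

lemma snoc_injective_iff (n : ℕ) (c : Fin n → ι) (l : ι) :
    Function.Injective (Fin.snoc c l : Fin (n + 1) → ι) ↔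
      Function.Injective c ∧ ∀ t, c t ≠ l := by
  rw [Fin.snoc_injective_iff]; simp

/-- The smallest neighbour bound of the vertex `b` of a wide melting lollipop. -/
def wlBound (m k b : ℕ) : ℕ := if b ≤ m - 2 then 0 else if b = m - 1 then k else b - 2

/-- Proper colourings with respect to the bounds `wlBound m k`. -/
def WLProper (m k : ℕ) {N : ℕ} (κ : Fin N → ι) : Prop :=
  ∀ a b : Fin N, (a : ℕ) < b → wlBound m k b ≤ a → κ a ≠ κ b

lemma wlGraph_proper_iff (m n k : ℕ) (κ : Fin (m + n) → ι) :
    (∀ a b, (WLgraph m n k).Adj a b → κ a ≠ κ b) ↔ WLProper m k κ := by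
  simp only [WLgraph, SimpleGraph.fromRel_adj]
  constructor
  · intro h a b hab hw
    exact h a b ⟨by rintro rfl; omega, Or.inl ⟨hab, hw⟩⟩
  · rintro h a b ⟨-, h1 | h1⟩
    · exact h a b h1.1 h1.2
    · exact (h b a h1.1 h1.2).symm

lemma wlProper_snoc (m k N : ℕ) (c : Fin N → ι) (l : ι) :
    WLProper m k (Fin.snoc c l : Fin (N + 1) → ι) ↔
      WLProper m k c ∧ ∀ a : Fin N, wlBound m k N ≤ a → c a ≠ l := by
  unfold WLProper
  constructor
  · intro h
    refine ⟨fun a b hab hw => ?_, fun a ha => ?_⟩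
    · simpa using h a.castSucc b.castSucc (by simpa using hab) (by simpa using hw)
    · simpa using h a.castSucc (Fin.last N) (by simp) (by simpa using ha)
  · rintro ⟨h1, h2⟩ a b hab hw
    induction b using Fin.lastCases with
    | last =>
      induction a using Fin.lastCases with
      | last => simp at hab
      | cast a => simpa using h2 a (by simpa using hw)
    | cast b =>
      induction a using Fin.lastCases with
      | last => simp at hab; omega
      | cast a => simpa using h1 a b (by simpa using hab) (by simpa using hw)

lemma wlProper_clique (s k N : ℕ) (hN : N ≤ s + 1) (c : Fin N → ι) :
    WLProper (s + 2) k c ↔ Function.Injective c := by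
  constructor
  · intro h a b hab
    by_contra hne
    have h0 : ∀ b : Fin N, wlBound (s + 2) k b = 0 := fun b => by
      have := b.2; simp [wlBound]; omega
    rcases lt_or_gt_of_ne hne with h1 | h1
    · exact h a b h1 (by simp [h0]) hab
    · exact h b a h1 (by simp [h0]) hab.symm
  · intro h a b hab _ he
    have := h he; subst this; omega

variable [Fintype ι]

lemma sum_snoc (n : ℕ) (F : (Fin (n + 1) → ι) → A) :
    ∑ κ, F κ = ∑ c : Fin n → ι, ∑ l, F (Fin.snoc c l) := by
  rw [← (Fin.snocEquiv fun _ : Fin (n + 1) => ι).sum_comp, Fintype.sum_prod_type, Finset.sum_comm]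
  rfl

variable [DecidableEq ι]

/-- Injective colourings of a sequence of vertices by colours in `S`. -/
lemma sum_injective (s : ℕ) (S : Finset ι) :
    ∑ c : Fin s → ι, (if Function.Injective c ∧ ∀ t, c t ∈ S then ∏ t, x (c t) else 0) =
      s.factorial * elemSum x S s := by
  induction s generalizing S with
  | zero => simp [Function.injective_of_subsingleton]
  | succ s ih =>
    rw [sum_snoc, Finset.sum_comm]
    have h : ∀ l, ∑ c : Fin s → ι, (if Function.Injective (Fin.snoc c l : Fin (s + 1) → ι) ∧
        ∀ t, (Fin.snoc c l : Fin (s + 1) → ι) t ∈ S then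
          ∏ t, x ((Fin.snoc c l : Fin (s + 1) → ι) t) else 0) =
        if l ∈ S then s.factorial * (x l * elemSum x (S.erase l) s) else 0 := by
      intro l
      split_ifs with hl
      · rw [mul_left_comm, ← ih, Finset.mul_sum]
        refine Finset.sum_congr rfl fun c _ => ?_
        rw [mul_ite, mul_zero, prod_snoc, mul_comm (x l)]
        refine if_congr ?_ rfl rfl
        rw [snoc_injective_iff, Fin.forall_fin_succ']
        simp only [Fin.snoc_castSucc, Fin.snoc_last, hl, and_true, Finset.mem_erase]
        exact ⟨fun h => ⟨h.1.1, fun t => ⟨h.1.2 t, h.2 t⟩⟩,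
          fun h => ⟨⟨h.1, fun t => (h.2 t).1⟩, fun t => (h.2 t).2⟩⟩
      · refine Finset.sum_eq_zero fun c _ => if_neg fun h => hl ?_
        simpa using h.2 (Fin.last s)
    rw [Finset.sum_congr rfl fun l _ => h l, ← Finset.sum_filter, ← Finset.mul_sum,
      Finset.filter_mem_eq_inter, Finset.univ_inter, sum_mul_elemSum_erase, Nat.factorial_succ]
    push_cast; ring

/-- Injective colourings of a sequence of vertices by colours in `S`, where only the first
`k + 1` vertices may use the colour `j`. -/
lemma sum_injective_melting (k u : ℕ) (S : Finset ι) (j : ι) (hj : j ∈ S) :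
    ∑ c : Fin (k + 1 + u) → ι, (if Function.Injective c ∧ (∀ t, c t ∈ S) ∧
        ∀ t : Fin (k + 1 + u), k + 1 ≤ (t : ℕ) → c t ≠ j then ∏ t, x (c t) else 0) =
      (k + 1 + u).factorial * elemSum x (S.erase j) (k + 1 + u) +
        (k + 1 : ℕ) * (k + u).factorial * (x j * elemSum x (S.erase j) (k + u)) := by
  induction u generalizing S with
  | zero =>
    have h : ∀ c : Fin (k + 1) → ι, (Function.Injective c ∧ (∀ t, c t ∈ S) ∧
        ∀ t : Fin (k + 1), k + 1 ≤ (t : ℕ) → c t ≠ j) ↔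
        (Function.Injective c ∧ ∀ t, c t ∈ S) := fun c =>
      ⟨fun h => ⟨h.1, h.2.1⟩, fun h => ⟨h.1, h.2, fun t ht => absurd t.2 (by omega)⟩⟩
    simp only [add_zero]
    rw [Finset.sum_congr rfl fun c _ => if_congr (h c) rfl rfl, sum_injective,
      elemSum_erase x hj, Nat.factorial_succ]
    push_cast; ring
  | succ u ih =>
    rw [← add_assoc, sum_snoc, Finset.sum_comm]
    have h : ∀ l, ∑ c : Fin (k + 1 + u) → ι,
        (if Function.Injective (Fin.snoc c l : Fin (k + 1 + u + 1) → ι) ∧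
          (∀ t, (Fin.snoc c l : Fin (k + 1 + u + 1) → ι) t ∈ S) ∧
          (∀ t : Fin (k + 1 + u + 1), k + 1 ≤ (t : ℕ) →
            (Fin.snoc c l : Fin (k + 1 + u + 1) → ι) t ≠ j) then
          ∏ t, x ((Fin.snoc c l : Fin (k + 1 + u + 1) → ι) t) else 0) =
        if l ∈ S.erase j then
          ((k + 1 + u).factorial * (x l * elemSum x ((S.erase j).erase l) (k + 1 + u)) +
          (k + 1 : ℕ) * (k + u).factorial * x j * (x l * elemSum x ((S.erase j).erase l) (k + u)))
        else 0 := by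
      intro l
      split_ifs with hl
      · have hlj := Finset.ne_of_mem_erase hl
        have hlS := Finset.mem_of_mem_erase hl
        have := ih (S.erase l) (by simp [hj, hlj.symm])
        rw [Finset.erase_right_comm]
        trans x l * ((k + 1 + u).factorial * elemSum x ((S.erase l).erase j) (k + 1 + u) +
          (k + 1 : ℕ) * (k + u).factorial * (x j * elemSum x ((S.erase l).erase j) (k + u)))
        · rw [← this, Finset.mul_sum]
          refine Finset.sum_congr rfl fun c _ => ?_
          rw [mul_ite, mul_zero, prod_snoc, mul_comm (x l)]
          refine if_congr ?_ rfl rfl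
          rw [snoc_injective_iff, Fin.forall_fin_succ', Fin.forall_fin_succ']
          simp only [Fin.snoc_castSucc, Fin.snoc_last, hlS, hlj, and_true, Finset.mem_erase,
            Fin.val_castSucc, ne_eq, not_false_eq_true, implies_true]
          exact ⟨fun h => ⟨h.1.1, fun t => ⟨h.1.2 t, h.2.1 t⟩, h.2.2⟩,
            fun h => ⟨⟨h.1, fun t => (h.2.1 t).1⟩, fun t => (h.2.1 t).2, h.2.2⟩⟩
        · ring
      · refine Finset.sum_eq_zero fun c _ => if_neg fun h => hl ?_
        have h1 := h.2.1 (Fin.last _)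
        have h2 := h.2.2 (Fin.last _) (by simp)
        rw [Fin.snoc_last] at h1 h2
        exact Finset.mem_erase.2 ⟨h2, h1⟩
    rw [Finset.sum_congr rfl fun l _ => h l, ← Finset.sum_filter, Finset.filter_mem_eq_inter,
      Finset.univ_inter, Finset.sum_add_distrib, ← Finset.mul_sum, ← Finset.mul_sum,
      sum_mul_elemSum_erase, sum_mul_elemSum_erase, Nat.factorial_succ (k + 1 + u),
      ← add_assoc k u 1, Nat.factorial_succ (k + u), show k + 1 + u = k + u + 1 by ring]
    push_cast; ring

/-- Proper colourings weighted by a function of the last two colours. -/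
def wlSum (s k n : ℕ) (φ : ι → ι → A) : A :=
  ∑ κ : Fin (s + 2 + n) → ι, if WLProper (s + 2) k κ then
    (∏ v, x (κ v)) * φ (κ ⟨s + n, by omega⟩) (κ ⟨s + 1 + n, by omega⟩) else 0

lemma wlSum_succ (s k n : ℕ) (φ : ι → ι → A) :
    wlSum x s k (n + 1) φ =
      wlSum x s k n fun i j => ∑ l, if l ≠ i ∧ l ≠ j then x l * φ j l else 0 := by
  unfold wlSum
  refine (sum_snoc (s + 2 + n) _).trans (Finset.sum_congr rfl fun c _ => ?_)
  have e1 : (⟨s + (n + 1), by omega⟩ : Fin (s + 2 + n + 1)) =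
      Fin.castSucc ⟨s + 1 + n, by omega⟩ := by ext; simp; omega
  have e2 : (⟨s + 1 + (n + 1), by omega⟩ : Fin (s + 2 + n + 1)) = Fin.last _ := by
    ext; simp; omega
  have hb : wlBound (s + 2) k (s + 2 + n) = s + n := by
    rw [wlBound, if_neg (by omega), if_neg (by omega)]; omega
  split_ifs with hc
  · rw [Finset.mul_sum]
    refine Finset.sum_congr rfl fun l _ => ?_
    rw [mul_ite, mul_zero]
    refine (if_congr ?_ ?_ rfl)
    · refine (wlProper_snoc (s + 2) k (s + 2 + n) c l).trans ?_
      rw [hb]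
      constructor
      · intro h
        exact ⟨(h.2 ⟨s + n, by omega⟩ le_rfl).symm,
          (h.2 ⟨s + 1 + n, by omega⟩ (by simp)).symm⟩
      · rintro ⟨h1, h2⟩
        refine ⟨hc, fun a ha => ?_⟩
        have : (a : ℕ) = s + n ∨ (a : ℕ) = s + 1 + n := by omega
        rcases this with h | h
        · rw [show a = ⟨s + n, by omega⟩ from Fin.ext h]; exact h1.symm
        · rw [show a = ⟨s + 1 + n, by omega⟩ from Fin.ext h]; exact h2.symm
    · have := prod_snoc x (s + 2 + n) c l
      refine (congrArg₂ (· * ·) this (congrArg₂ φ (congrArg _ e1) (congrArg _ e2))).trans ?_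
      rw [Fin.snoc_castSucc, Fin.snoc_last]
      ring
  · refine Finset.sum_eq_zero fun l _ => if_neg fun h => hc ?_
    exact ((wlProper_snoc (s + 2) k (s + 2 + n) c l).1 h).1

lemma wlSum_ladderTail (s k n n' : ℕ) (r : ι) :
    wlSum x s k n (fun i j => ladderTail x n' i j r) =
      wlSum x s k 0 fun i j => ladderTail x (n' + n) i j r := by
  induction n generalizing n' with
  | zero => rfl
  | succ n ih =>
    rw [wlSum_succ]
    have := ih (n' + 1)
    rw [show n' + 1 + n = n' + (n + 1) by ring] at this
    exact this

lemma wlSum_zero (k u : ℕ) (φ : ι → ι → A) :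
    wlSum x (k + 1 + u) (k + 1) 0 φ = ∑ i, ∑ j, if i ≠ j then x i * x j *
      ((k + 1 + u).factorial * elemSum x ((Finset.univ.erase i).erase j) (k + 1 + u) +
        (k + 1 : ℕ) * (k + u).factorial *
          (x j * elemSum x ((Finset.univ.erase i).erase j) (k + u))) * φ i j else 0 := by
  set s := k + 1 + u with hs
  have hw : ∀ (c : Fin s → ι) (i j : ι),
      WLProper (s + 2) (k + 1) (Fin.snoc (Fin.snoc c i : Fin (s + 1) → ι) j : Fin (s + 2) → ι) ↔
      i ≠ j ∧ Function.Injective c ∧ (∀ t, c t ∈ Finset.univ.erase i) ∧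
        ∀ t : Fin s, k + 1 ≤ (t : ℕ) → c t ≠ j := by
    intro c i j
    rw [wlProper_snoc, wlProper_clique s _ _ le_rfl, snoc_injective_iff, Fin.forall_fin_succ']
    have : wlBound (s + 2) (k + 1) (s + 1) = k + 1 := by simp [wlBound]
    rw [this]
    have h2 : k + 1 ≤ s := by omega
    simp only [Fin.snoc_castSucc, Fin.snoc_last, Fin.val_castSucc, Fin.val_last, h2,
      Finset.mem_erase, Finset.mem_univ, and_true, true_imp_iff]
    tauto
  have h1 : wlSum x s (k + 1) 0 φ = ∑ c : Fin s → ι, ∑ i, ∑ j,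
      if i ≠ j ∧ Function.Injective c ∧ (∀ t, c t ∈ Finset.univ.erase i) ∧
        (∀ t : Fin s, k + 1 ≤ (t : ℕ) → c t ≠ j) then
          (∏ t, x (c t)) * x i * x j * φ i j else 0 := by
    unfold wlSum
    refine (sum_snoc (s + 1) _).trans ((sum_snoc s _).trans ?_)
    refine Finset.sum_congr rfl fun c _ => Finset.sum_congr rfl fun i _ =>
      Finset.sum_congr rfl fun j _ => ?_
    refine if_congr (hw c i j) ?_ rfl
    have e1 : (⟨s + 0, by omega⟩ : Fin (s + 1 + 1)) = Fin.castSucc (Fin.last s) := by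
      ext; simp
    have e2 : (⟨s + 1 + 0, by omega⟩ : Fin (s + 1 + 1)) = Fin.last _ := by ext; simp
    refine (congrArg₂ (· * ·) (prod_snoc x (s + 1) (Fin.snoc c i) j)
      (congrArg₂ φ (congrArg _ e1) (congrArg _ e2))).trans ?_
    rw [prod_snoc, Fin.snoc_castSucc, Fin.snoc_last, Fin.snoc_last]
  rw [h1, Finset.sum_comm]
  refine Finset.sum_congr rfl fun i _ => ?_
  rw [Finset.sum_comm]
  refine Finset.sum_congr rfl fun j _ => ?_
  split_ifs with hij
  · have hj : j ∈ Finset.univ.erase i := by simp [Ne.symm hij]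
    rw [← sum_injective_melting x k u _ j hj, Finset.mul_sum, Finset.sum_mul]
    refine Finset.sum_congr rfl fun c _ => ?_
    simp only [hij, ne_eq, not_false_eq_true, true_and, mul_ite, mul_zero, ite_mul, zero_mul]
    refine if_congr Iff.rfl ?_ rfl
    ring
  · exact Finset.sum_eq_zero fun c _ => if_neg fun h => hij h.1

lemma wlSum_eq (k u n : ℕ) (r : ι) :
    wlSum x (k + 1 + u) (k + 1) n (fun i j => ladderTail x 0 i j r) =
      (((k + 1) * (k + u).factorial) • cliqueLadder x (k + u + 2) (n + 2) +
        (u * (k + u).factorial) • cliqueTail x (k + u + 3) n) r := by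
  rw [wlSum_ladderTail, wlSum_zero, zero_add]
  simp only [Pi.add_apply, Pi.smul_apply, cliqueLadder, ladderAppend, ladderGlue, cliqueTail,
    Finset.smul_sum, ← Finset.sum_add_distrib]
  refine Finset.sum_congr rfl fun i _ => Finset.sum_congr rfl fun j _ => ?_
  split_ifs with hij
  · have hj : j ∈ Finset.univ.erase i := by simp [Ne.symm hij]
    rw [rootedClique, elemSum_erase x hj, show k + 1 + u = k + u + 1 by ring, Nat.factorial_succ,
      show k + u + 3 - 2 = k + u + 1 by omega]
    simp only [nsmul_eq_mul, Pi.one_apply]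
    push_cast
    ring
  · simp

/-- The generating function of a wide melting lollipop lies in the cone. -/
theorem cliqueCone_wlSum (k u n : ℕ) :
    CliqueCone x (k + 1 + u + 2 + n)
      fun r => wlSum x (k + 1 + u) (k + 1) n fun i j => ladderTail x 0 i j r := by
  rw [show (fun r => wlSum x (k + 1 + u) (k + 1) n fun i j => ladderTail x 0 i j r) = _ from
    funext (wlSum_eq x k u n)]
  refine CliqueCone.add (CliqueCone.nsmul _ ?_) (CliqueCone.nsmul _ ?_)
  · have := (cliqueCone_cliqueLadder x (n + 2)).1 (k + u + 2) (by omega)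
    rwa [show k + u + 2 + (n + 2) - 1 = k + 1 + u + 2 + n by omega] at this
  · have := cliqueCone_cliqueTail x (k + u + 1) n fun k r _ hk =>
      (cliqueCone_cliqueLadder x r).1 k (by omega)
    rwa [show k + u + 1 + 2 + n = k + 1 + u + 2 + n by ring] at this

end Melting

/-! ### Realizing the cone by set partitions -/

section Realization

variable {ι A V : Type} [CommRing A] (x : ι → A) [Fintype ι] [Fintype V] [DecidableEq V]

/-- Splitting colourings along a set of vertices. -/
lemma sum_pi_split (p : V → Prop) [DecidablePred p] (F : ({v // p v} → ι) → ({v // ¬ p v} → ι) → A) :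
    ∑ κ : V → ι, F (fun v => κ v) (fun v => κ v) = ∑ κ₁, ∑ κ₂, F κ₁ κ₂ := by
  rw [← Fintype.sum_prod_type', ← (Equiv.piEquivPiSubtypeProd p fun _ => ι).sum_comp]
  rfl

variable [DecidableEq ι]

lemma CliqueCone.eq_zero_of_degree_zero {N : ℕ} {g : ι → A} (h : CliqueCone x N g) (hN : N = 0) :
    g = 0 := by
  induction h with
  | zero => rfl
  | add _ _ ih₁ ih₂ => rw [ih₁ hN, ih₂ hN, add_zero]
  | clique b => omega
  | elem_smul k _ ih => rw [ih (by omega), smul_zero]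

lemma sum_injective_type (S : Finset ι) :
    ∑ c : V → ι, (if Function.Injective c ∧ ∀ t, c t ∈ S then ∏ t, x (c t) else 0) =
      (Fintype.card V).factorial * elemSum x S (Fintype.card V) := by
  rw [← sum_injective, ← (Equiv.arrowCongr (Fintype.equivFin V) (Equiv.refl ι)).sum_comp]
  refine Finset.sum_congr rfl fun c _ => ?_
  refine if_congr (and_congr ?_ ?_) ?_ rfl
  · exact ((Fintype.equivFin V).symm.injective_comp c).symm
  · exact (Fintype.equivFin V).forall_congr_left
  · rw [← (Fintype.equivFin V).prod_comp]; simp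

variable [Algebra ℚ A]

/-- Colourings in which equivalent vertices get distinct colours. -/
def SetoidProper (s : Setoid V) (κ : V → ι) : Prop := ∀ u v, u ≠ v → s u v → κ u ≠ κ v

/-- The generating function of such colourings, rooted at `a`. -/
def setoidSum (s : Setoid V) (a : V) (r : ι) : A :=
  ∑ κ : V → ι, if κ a = r ∧ SetoidProper s κ then ∏ v, x (κ v) else 0

/-- Nonnegative combinations of the functions `setoidSum`. -/
def setoidCone (a : V) : AddSubmonoid (ι → A) :=
  AddSubmonoid.closure {g | ∃ c : ℚ, 0 ≤ c ∧ ∃ s : Setoid V, g = c • setoidSum x s a}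

lemma setoidSum_mem_setoidCone {c : ℚ} (hc : 0 ≤ c) (s : Setoid V) (a : V) :
    c • setoidSum x s a ∈ setoidCone x a :=
  AddSubmonoid.subset_closure ⟨c, hc, s, rfl⟩

lemma setoidSum_top (a : V) (b : ℕ) (hV : Fintype.card V = b + 1) :
    setoidSum x (⊤ : Setoid V) a = (b.factorial : ℚ) • cliqueLadder x (b + 1) 1 := by
  ext r
  have hcard : Fintype.card {v // v ≠ a} = b := by
    rw [Fintype.card_subtype_compl, Fintype.card_subtype_eq, hV]; rfl
  let F (i : ι) (κ₂ : {v // v ≠ a} → ι) : A :=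
    if i = r then x r * (if Function.Injective κ₂ ∧ ∀ t, κ₂ t ∈ Finset.univ.erase r
      then ∏ t, x (κ₂ t) else 0) else 0
  have h1 : setoidSum x (⊤ : Setoid V) a r = ∑ κ : V → ι, F (κ a) (fun v => κ v) := by
    refine Finset.sum_congr rfl fun κ _ => ?_
    simp only [F]
    by_cases hr : κ a = r
    · rw [if_pos hr, mul_ite, mul_zero]
      refine if_congr ?_ ?_ rfl
      · rw [SetoidProper]
        constructor
        · rintro ⟨-, h⟩
          refine ⟨fun u v huv => ?_, fun t => ?_⟩
          · by_contra hne
            exact h u v (fun h' => hne (Subtype.ext h')) trivial huv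
          · rw [← hr]; simpa using h t a t.2 trivial
        · rintro ⟨h1, h2⟩
          refine ⟨hr, fun u v huv _ he => huv ?_⟩
          by_cases hu : u = a
          · by_cases hv : v = a
            · rw [hu, hv]
            · have := h2 ⟨v, hv⟩
              simp [← he, hu, hr] at this
          · by_cases hv : v = a
            · have := h2 ⟨u, hu⟩
              simp [he, hv, hr] at this
            · exact congrArg Subtype.val (@h1 ⟨u, hu⟩ ⟨v, hv⟩ he)
      · rw [Fintype.prod_eq_mul_prod_subtype_ne _ a, hr]
    · rw [if_neg (fun h => hr h.1), if_neg hr]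
  have h2 : ∑ κ : V → ι, F (κ a) (fun v => κ v) = ∑ i, ∑ κ₂, F i κ₂ := by
    rw [← Fintype.sum_prod_type', ← (Equiv.funSplitAt a ι).sum_comp]
    rfl
  have h3 : ∀ i, ∑ κ₂ : {v // v ≠ a} → ι, F i κ₂ = if i = r then
      x r * (b.factorial * elemSum x (Finset.univ.erase r) b) else 0 := by
    intro i
    simp only [F]
    split_ifs
    · rw [← Finset.mul_sum, sum_injective_type, hcard]
    · simp
  rw [h1, h2, Finset.sum_congr rfl fun i _ => h3 i]
  simp [ladderAppend, rootedClique, Algebra.smul_def]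
  ring

/-- Extending an equivalence relation by one further class. -/
def extendSetoid (p : V → Prop) (s : Setoid {v // p v}) : Setoid V where
  r u v := (∃ hu hv, s ⟨u, hu⟩ ⟨v, hv⟩) ∨ (¬ p u ∧ ¬ p v)
  iseqv :=
    { refl := fun u => by
        by_cases hu : p u
        · exact Or.inl ⟨hu, hu, s.refl _⟩
        · exact Or.inr ⟨hu, hu⟩
      symm := by
        rintro u v (⟨hu, hv, h⟩ | ⟨hu, hv⟩)
        · exact Or.inl ⟨hv, hu, s.symm h⟩
        · exact Or.inr ⟨hv, hu⟩
      trans := by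
        rintro u v w (⟨hu, hv, h⟩ | ⟨hu, hv⟩) (⟨hv', hw, h'⟩ | ⟨hv', hw⟩)
        · exact Or.inl ⟨hu, hw, s.trans h h'⟩
        · exact absurd hv hv'
        · exact absurd hv' hv
        · exact Or.inr ⟨hu, hw⟩ }

lemma setoidSum_extendSetoid (p : V → Prop) [DecidablePred p] (s : Setoid {v // p v}) (a : V) (ha : p a) (k : ℕ)
    (hk : Fintype.card {v // ¬ p v} = k) :
    setoidSum x (extendSetoid p s) a =
      (k.factorial : ℚ) • elemAll x k • setoidSum x s ⟨a, ha⟩ := by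
  ext r
  let F (κ₁ : {v // p v} → ι) (κ₂ : {v // ¬ p v} → ι) : A :=
    (if κ₁ ⟨a, ha⟩ = r ∧ SetoidProper s κ₁ then ∏ v, x (κ₁ v) else 0) *
      (if Function.Injective κ₂ ∧ ∀ t, κ₂ t ∈ Finset.univ then ∏ t, x (κ₂ t) else 0)
  have h1 : setoidSum x (extendSetoid p s) a r =
      ∑ κ : V → ι, F (fun v => κ v) (fun v => κ v) := by
    refine Finset.sum_congr rfl fun κ _ => ?_
    simp only [F]
    rw [ite_zero_mul_ite_zero, Fintype.prod_subtype_mul_prod_subtype p fun v => x (κ v)]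
    refine if_congr ?_ rfl rfl
    constructor
    · rintro ⟨hr, h⟩
      refine ⟨⟨hr, fun u v huv hs => ?_⟩, fun u v huv => ?_, fun t => Finset.mem_univ _⟩
      · exact h u v (fun h' => huv (Subtype.ext h')) (Or.inl ⟨u.2, v.2, hs⟩)
      · by_contra hne
        exact h u v (fun h' => hne (Subtype.ext h')) (Or.inr ⟨u.2, v.2⟩) huv
    · rintro ⟨⟨hr, h⟩, h', -⟩
      refine ⟨hr, ?_⟩
      rintro u v huv (⟨hu, hv, hs⟩ | ⟨hu, hv⟩)
      · exact h ⟨u, hu⟩ ⟨v, hv⟩ (fun h' => huv (congrArg Subtype.val h')) hs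
      · exact fun he => huv (congrArg Subtype.val (@h' ⟨u, hu⟩ ⟨v, hv⟩ he))
  rw [h1, sum_pi_split p F, ← Finset.sum_mul_sum, sum_injective_type, hk]
  simp [setoidSum, Algebra.smul_def]
  ring

/-- The cone of degree `N` is realized by equivalence relations on `N` vertices. -/
theorem CliqueCone.mem_setoidCone {N : ℕ} {g : ι → A} (h : CliqueCone x N g) :
    ∀ (V : Type) [Fintype V] [DecidableEq V] (a : V), Fintype.card V = N →
      g ∈ setoidCone x a := by
  induction h with
  | zero => intro V _ _ a _; exact zero_mem _
  | add _ _ ih₁ ih₂ => intro V _ _ a hV; exact add_mem (ih₁ V a hV) (ih₂ V a hV)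
  | clique b =>
    intro V _ _ a hV
    have := setoidSum_mem_setoidCone x (c := (b.factorial : ℚ)⁻¹) (by positivity) ⊤ a
    rwa [setoidSum_top x a b hV, smul_smul, inv_mul_cancel₀ (by positivity), one_smul] at this
  | @elem_smul N g k hg ih =>
    intro V _ _ a hV
    rcases Nat.eq_zero_or_pos N with hN | hN
    · rw [hg.eq_zero_of_degree_zero x hN, smul_zero]; exact zero_mem _
    obtain ⟨B, hB, hBk⟩ := Finset.exists_subset_card_eq (s := Finset.univ.erase a) (n := k)
      (by rw [Finset.card_erase_of_mem (Finset.mem_univ a), Finset.card_univ, hV]; omega)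
    have ha : a ∉ B := fun h => by simpa using hB h
    have hk : Fintype.card {v // ¬ v ∉ B} = k := by simp [hBk]
    have hW : Fintype.card {v // v ∉ B} = N := by
      have := Fintype.card_subtype_compl (fun v => v ∈ B)
      rw [this, hV, Fintype.card_coe, hBk]; omega
    have hmem := ih {v // v ∉ B} ⟨a, ha⟩ hW
    refine AddSubmonoid.closure_induction (motive := fun g _ => elemAll x k • g ∈ setoidCone x a)
      ?_ ?_ ?_ hmem
    · rintro _ ⟨c, hc, s, rfl⟩
      have := setoidSum_mem_setoidCone x (c := c * (k.factorial : ℚ)⁻¹) (by positivity)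
        (extendSetoid (fun v => v ∉ B) s) a
      rwa [setoidSum_extendSetoid x _ s a ha k hk, smul_smul, mul_assoc,
        inv_mul_cancel₀ (by positivity), mul_one, smul_comm] at this
    · rw [smul_zero]; exact zero_mem _
    · intro g h _ _ hg hh
      rw [smul_add]; exact add_mem hg hh

end Realization

/-! ### The span of the elementary functions -/

section ElementarySpan

variable {d : ℕ}

/-- The power sum function: the indicator of words constant on equivalence classes. -/
def powerFn (r : Setoid (Fin d)) : Md d := fun w => if r ≤ Setoid.ker w then 1 else 0

/-- The span of the functions `eSP π`. -/
def elemSpan (d : ℕ) : Submodule ℚ (Md d) := Submodule.span ℚ (Set.range eSP)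

lemma sameBlock_ofSetoid (r : Setoid (Fin d)) (j k : Fin d) :
    sameBlock (Finpartition.ofSetoid r) j k ↔ r j k := by
  rw [← Finpartition.mem_part_ofSetoid_iff_rel, Finpartition.mem_part_iff_exists]
  simp only [sameBlock, and_comm (a := j ∈ _)]

lemma eSP_ofSetoid (r : Setoid (Fin d)) (w : NCWord d) :
    eSP (Finpartition.ofSetoid r) w = if SetoidProper r w then 1 else 0 := by
  simp only [eSP, SetoidProper, sameBlock_ofSetoid]
  congr

lemma powerFn_mul_eq (r : Setoid (Fin d)) (j k : Fin d) (w : NCWord d) :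
    powerFn r w * (if w j = w k then 1 else 0) =
      powerFn (r ⊔ Relation.EqvGen.setoid fun a b => a = j ∧ b = k) w := by
  have : Relation.EqvGen.setoid (fun a b => a = j ∧ b = k) ≤ Setoid.ker w ↔ w j = w k := by
    constructor
    · intro h
      exact h (Relation.EqvGen.rel _ _ ⟨rfl, rfl⟩)
    · intro h
      refine Setoid.eqvGen_le ?_
      rintro _ _ ⟨rfl, rfl⟩
      exact h
  simp only [powerFn, sup_le_iff, this]
  split_ifs <;> simp_all

lemma prod_ne_mul_powerFn_mem (F : Finset (Fin d × Fin d)) :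
    ∀ r : Setoid (Fin d), (fun w : NCWord d =>
      (∏ e ∈ F, (1 - if w e.1 = w e.2 then (1 : ℚ) else 0)) * powerFn r w) ∈
        Submodule.span ℚ (Set.range (powerFn (d := d))) := by
  induction F using Finset.induction_on with
  | empty =>
    intro r
    refine Submodule.subset_span ⟨r, ?_⟩
    ext w
    simp
  | insert e F he ih =>
    intro r
    convert Submodule.sub_mem _ (ih r)
      (ih (r ⊔ Relation.EqvGen.setoid fun a b => a = e.1 ∧ b = e.2)) using 1
    ext w
    rw [Finset.prod_insert he, Pi.sub_apply, ← powerFn_mul_eq]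
    ring

lemma YG_mem_span_powerFn (G : SimpleGraph (Fin d)) :
    YG G ∈ Submodule.span ℚ (Set.range (powerFn (d := d))) := by
  convert prod_ne_mul_powerFn_mem (Finset.univ.filter fun e : Fin d × Fin d => G.Adj e.1 e.2) ⊥
    using 1
  ext w
  have h1 : powerFn ⊥ w = 1 := if_pos bot_le
  rw [h1, mul_one]
  by_cases h : ∀ j k : Fin d, G.Adj j k → w j ≠ w k
  · rw [YG, if_pos h, Finset.prod_eq_one]
    intro e he
    rw [if_neg (h _ _ (Finset.mem_filter.1 he).2), sub_zero]
  · rw [YG, if_neg h]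
    push Not at h
    obtain ⟨j, k, hjk, hw⟩ := h
    rw [Finset.prod_eq_zero (i := (j, k)) (by simpa using hjk) (by simp [hw])]

/-- The indicator of proper words factors over the positions. -/
lemma setoidProper_eq_prod (r : Setoid (Fin d)) (w : NCWord d) :
    (if SetoidProper r w then (1 : ℚ) else 0) =
      ∏ x, ∑ u ∈ Finset.univ.filter (fun u => u ≤ x ∧ r u x),
        if u = x then 1 else -(if w x = w u then 1 else 0) := by
  have hsplit (x : Fin d) : (∑ u ∈ Finset.univ.filter (fun u => u ≤ x ∧ r u x),
      if u = x then (1 : ℚ) else -(if w x = w u then 1 else 0)) =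
      1 - ∑ u, if u < x ∧ r u x ∧ w u = w x then 1 else 0 := by
    rw [Finset.sum_filter, ← Finset.add_sum_erase _ _ (Finset.mem_univ x),
      ← Finset.add_sum_erase (a := x) (s := Finset.univ) (f := fun u => if u < x ∧ r u x ∧ w u = w x
        then (1 : ℚ) else 0) (Finset.mem_univ x), if_pos ⟨le_rfl, r.refl x⟩, if_pos rfl,
      if_neg (fun h => lt_irrefl _ h.1), zero_add, sub_eq_add_neg, ← Finset.sum_neg_distrib]
    congr 1
    refine Finset.sum_congr rfl fun u hu => ?_
    have hux : u ≠ x := Finset.ne_of_mem_erase hu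
    simp only [if_neg hux, eq_comm (a := w x), lt_iff_le_and_ne]
    by_cases h1 : u ≤ x <;> by_cases h2 : r u x <;> by_cases h3 : w u = w x <;>
      simp [h1, h2, h3, hux]
  simp only [hsplit]
  by_cases h : SetoidProper r w
  · rw [if_pos h, Finset.prod_eq_one]
    intro x _
    rw [Finset.sum_eq_zero, sub_zero]
    intro u _
    exact if_neg fun hu => h u x hu.1.ne hu.2.1 hu.2.2
  · rw [if_neg h]
    let B : Finset (Fin d) := Finset.univ.filter fun x => ∃ t < x, r t x ∧ w t = w x
    have hB : B.Nonempty := by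
      simp only [SetoidProper] at h
      push Not at h
      obtain ⟨u, v, huv, hr, hw⟩ := h
      rcases lt_or_gt_of_ne huv with hlt | hlt
      · exact ⟨v, by simpa [B] using ⟨u, hlt, hr, hw⟩⟩
      · exact ⟨u, by simpa [B] using ⟨v, hlt, r.symm hr, hw.symm⟩⟩
    obtain ⟨x, hx, hmin⟩ := B.exists_min_image id hB
    obtain ⟨t, htx, hrt, hwt⟩ := (Finset.mem_filter.1 hx).2
    refine (Finset.prod_eq_zero (Finset.mem_univ x) ?_).symm
    rw [Finset.sum_eq_single t, if_pos ⟨htx, hrt, hwt⟩, sub_self]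
    · intro u _ hut
      refine if_neg ?_
      rintro ⟨hux, hru, hwu⟩
      rcases lt_or_gt_of_ne hut with hlt | hlt
      · exact absurd (hmin t (Finset.mem_filter.2 ⟨Finset.mem_univ _,
          u, hlt, r.trans hru (r.symm hrt), hwu.trans hwt.symm⟩)) (not_le.2 htx)
      · exact absurd (hmin u (Finset.mem_filter.2 ⟨Finset.mem_univ _,
          t, hlt, r.trans hrt (r.symm hru), hwt.trans hwu.symm⟩)) (not_le.2 hux)
    · simp

/-- The equivalence relation generated by `x ∼ φ x`. -/
def mapSetoid (φ : Fin d → Fin d) : Setoid (Fin d) := Relation.EqvGen.setoid fun x y => y = φ x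

lemma mapSetoid_le_iff (φ : Fin d → Fin d) (r : Setoid (Fin d)) :
    mapSetoid φ ≤ r ↔ ∀ x, r x (φ x) := by
  constructor
  · intro h x
    exact h (Relation.EqvGen.rel _ _ rfl)
  · intro h
    refine Setoid.eqvGen_le ?_
    rintro x _ rfl
    exact h x

/-- The sign of a self-map, counting the points that are moved. -/
def mapSign (φ : Fin d → Fin d) : ℚ := ∏ x, if φ x = x then 1 else -1

lemma prod_map_eq (φ : Fin d → Fin d) (w : NCWord d) :
    (∏ x, if φ x = x then (1 : ℚ) else -(if w x = w (φ x) then 1 else 0)) =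
      mapSign φ * powerFn (mapSetoid φ) w := by
  have hp : powerFn (mapSetoid φ) w = ∏ x, if w x = w (φ x) then (1 : ℚ) else 0 := by
    rw [Finset.prod_ite_zero, powerFn]
    simp only [mapSetoid_le_iff, Finset.mem_univ, true_imp_iff, Finset.prod_const_one]
    exact if_congr Iff.rfl rfl rfl
  rw [hp, mapSign, ← Finset.prod_mul_distrib]
  refine Finset.prod_congr rfl fun x _ => ?_
  by_cases h : φ x = x
  · simp [h]
  · by_cases hw : w x = w (φ x) <;> simp [h, hw]

/-- The self-maps sending every point to an equivalent point that is not larger. -/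
def loweringMaps (r : Setoid (Fin d)) : Finset (Fin d → Fin d) :=
  Fintype.piFinset fun x => Finset.univ.filter fun u => u ≤ x ∧ r u x

lemma mem_loweringMaps {r : Setoid (Fin d)} {φ : Fin d → Fin d} :
    φ ∈ loweringMaps r ↔ ∀ x, φ x ≤ x ∧ r (φ x) x := by
  simp [loweringMaps]

lemma eSP_ofSetoid_eq_sum (r : Setoid (Fin d)) :
    eSP (Finpartition.ofSetoid r) =
      ∑ φ ∈ loweringMaps r, mapSign φ • powerFn (mapSetoid φ) := by
  ext w
  rw [eSP_ofSetoid, setoidProper_eq_prod, Finset.prod_univ_sum, Finset.sum_apply]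
  exact Finset.sum_congr rfl fun φ _ => prod_map_eq φ w

lemma mapSign_eq_of_mapSetoid_eq {r : Setoid (Fin d)} {φ : Fin d → Fin d}
    (hφ : φ ∈ loweringMaps r) (h : mapSetoid φ = r) :
    mapSign φ = ∏ x, if ∀ y, r y x → x ≤ y then (1 : ℚ) else -1 := by
  rw [mem_loweringMaps] at hφ
  refine Finset.prod_congr rfl fun x _ => if_congr ?_ rfl rfl
  constructor
  · intro hx y hyx
    have hle (n : ℕ) (z : Fin d) : φ^[n] z ≤ z := by
      induction n with
      | zero => exact le_rfl
      | succ n ih =>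
        rw [Function.iterate_succ_apply']
        exact (hφ _).1.trans ih
    have hker : mapSetoid φ ≤ Setoid.ker fun z => ∃ n : ℕ, φ^[n] z = x := by
      rw [mapSetoid_le_iff]
      intro z
      refine propext ⟨?_, ?_⟩
      · rintro ⟨n, hn⟩
        refine ⟨n, ?_⟩
        rw [← Function.iterate_succ_apply, Function.iterate_succ_apply', hn, hx]
      · rintro ⟨n, hn⟩
        exact ⟨n + 1, hn⟩
    rw [h] at hker
    have hiff : (∃ n : ℕ, φ^[n] y = x) = ∃ n : ℕ, φ^[n] x = x := hker hyx
    obtain ⟨n, hn⟩ := hiff.mpr ⟨0, rfl⟩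
    exact hn ▸ hle n y
  · intro hx
    exact le_antisymm (hφ x).1 (hx _ (hφ x).2)

lemma exists_mapSetoid_eq (r : Setoid (Fin d)) : ∃ φ ∈ loweringMaps r, mapSetoid φ = r := by
  have hex (x : Fin d) : ∃ u, r u x ∧ ∀ y, r y x → u ≤ y := by
    obtain ⟨u, hu, hmin⟩ := (Finset.univ.filter fun u => r u x).exists_min_image id
      ⟨x, by simp⟩
    exact ⟨u, (Finset.mem_filter.1 hu).2, fun y hy => hmin y (by simpa using hy)⟩
  choose φ hφ hmin using hex
  refine ⟨φ, mem_loweringMaps.2 fun x => ⟨hmin x x (r.refl x), hφ x⟩, le_antisymm ?_ ?_⟩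
  · exact (mapSetoid_le_iff _ _).2 fun x => r.symm (hφ x)
  · intro x y hxy
    have hle := (mapSetoid_le_iff φ _).1 le_rfl
    have : φ x = φ y := le_antisymm (hmin _ _ (r.trans (hφ y) (r.symm hxy)))
      (hmin _ _ (r.trans (hφ x) hxy))
    exact (mapSetoid φ).trans (hle x) (this ▸ (mapSetoid φ).symm (hle y))

lemma finite_setoid (d : ℕ) : Finite (Setoid (Fin d)) :=
  Finite.of_injective (fun (r : Setoid (Fin d)) x y => r x y) fun _ _ h =>
    Setoid.ext fun x y => iff_of_eq (congrFun (congrFun h x) y)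

lemma powerFn_mem_elemSpan (r : Setoid (Fin d)) : powerFn r ∈ elemSpan d := by
  have := finite_setoid d
  induction r using WellFoundedLT.induction with
  | ind r ih =>
  have hsum := eSP_ofSetoid_eq_sum r
  rw [← Finset.sum_filter_add_sum_filter_not _ fun φ => mapSetoid φ = r] at hsum
  have hlow : ∑ φ ∈ (loweringMaps r).filter (fun φ => ¬ mapSetoid φ = r),
      mapSign φ • powerFn (mapSetoid φ) ∈ elemSpan d := by
    refine Submodule.sum_mem _ fun φ hφ => Submodule.smul_mem _ _ (ih _ ?_)
    rw [Finset.mem_filter, mem_loweringMaps] at hφ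
    exact lt_of_le_of_ne ((mapSetoid_le_iff _ _).2 fun x => r.symm (hφ.1 x).2) hφ.2
  have htop : ∑ φ ∈ (loweringMaps r).filter (fun φ => mapSetoid φ = r),
      mapSign φ • powerFn (mapSetoid φ) =
      ((((loweringMaps r).filter fun φ => mapSetoid φ = r).card : ℚ) *
        ∏ x, if ∀ y, r y x → x ≤ y then (1 : ℚ) else -1) • powerFn r := by
    rw [Finset.sum_congr rfl (g := fun _ =>
      (∏ x, if ∀ y, r y x → x ≤ y then (1 : ℚ) else -1) • powerFn r), Finset.sum_const,
      mul_smul, Nat.cast_smul_eq_nsmul]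
    intro φ hφ
    rw [Finset.mem_filter] at hφ
    rw [mapSign_eq_of_mapSetoid_eq hφ.1 hφ.2, hφ.2]
  have hmem : ((((loweringMaps r).filter fun φ => mapSetoid φ = r).card : ℚ) *
        ∏ x, if ∀ y, r y x → x ≤ y then (1 : ℚ) else -1) • powerFn r ∈ elemSpan d := by
    rw [← htop, ← sub_eq_of_eq_add hsum]
    exact Submodule.sub_mem _ (Submodule.subset_span ⟨_, rfl⟩) hlow
  refine (Submodule.smul_mem_iff _ (mul_ne_zero ?_ ?_)).1 hmem
  · obtain ⟨φ, hφ, h⟩ := exists_mapSetoid_eq r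
    exact Nat.cast_ne_zero.2 (Finset.card_ne_zero_of_mem (Finset.mem_filter.2 ⟨hφ, h⟩))
  · exact Finset.prod_ne_zero_iff.2 fun x _ => by split_ifs <;> norm_num

lemma YG_mem_elemSpan (G : SimpleGraph (Fin d)) : YG G ∈ elemSpan d := by
  refine Submodule.span_le.2 ?_ (YG_mem_span_powerFn G)
  rintro _ ⟨r, rfl⟩
  exact powerFn_mem_elemSpan r

end ElementarySpan

/-! ### Symmetrization over the permutations fixing the root -/

section Symmetrization

variable {d : ℕ}

/-- The image of a set partition under a permutation. -/
def permPtn (σ : Equiv.Perm (Fin d)) (π : SetPtn d) : SetPtn d :=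
  (π.map (e := { Equiv.finsetCongr σ with
    map_rel_iff' := fun {_ _} => Finset.map_subset_map })).copy (Finset.map_univ_equiv σ)

lemma parts_permPtn (σ : Equiv.Perm (Fin d)) (π : SetPtn d) :
    (permPtn σ π).parts = π.parts.map (Equiv.finsetCongr σ).toEmbedding := rfl

lemma sameBlock_permPtn (σ : Equiv.Perm (Fin d)) (π : SetPtn d) (j k : Fin d) :
    sameBlock (permPtn σ π) (σ j) (σ k) ↔ sameBlock π j k := by
  rw [sameBlock, sameBlock, ← (Equiv.finsetCongr σ).exists_congr_right]
  refine exists_congr fun B => and_congr ?_ ?_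
  · rw [parts_permPtn, ← Equiv.coe_toEmbedding, Finset.mem_map']
  · simp

lemma blockOf_permPtn (σ : Equiv.Perm (Fin d)) (π : SetPtn d) (a : Fin d) :
    blockOf (permPtn σ π) (σ a) = Equiv.finsetCongr σ (blockOf π a) := by
  ext k
  obtain ⟨k, rfl⟩ := σ.surjective k
  simp [blockOf, sameBlock_permPtn]

lemma ptype_permPtn (σ : Equiv.Perm (Fin d)) (π : SetPtn d) (a : Fin d) (h : σ a = a) :
    ptype (permPtn σ π) a = ptype π a := by
  have hb : blockOf (permPtn σ π) a = Equiv.finsetCongr σ (blockOf π a) := by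
    rw [← blockOf_permPtn, h]
  rw [ptype, ptype, hb, parts_permPtn, ← Equiv.coe_toEmbedding, ← Finset.map_erase,
    Finset.map_val, Multiset.map_map]
  simp [Function.comp_def]

lemma eSP_permPtn (σ : Equiv.Perm (Fin d)) (π : SetPtn d) (w : NCWord d) :
    eSP (permPtn σ π) w = eSP π (w ∘ σ) := by
  refine if_congr ?_ rfl rfl
  rw [← σ.forall_congr_right]
  refine forall_congr' fun j => ?_
  rw [← σ.forall_congr_right]
  simp [sameBlock_permPtn]

lemma sub_comp_perm_mem_Ksub {f : Md d} (hf : f ∈ elemSpan d) {a : Fin d}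
    {σ : Equiv.Perm (Fin d)} (h : σ a = a) : (f - fun w => f (w ∘ σ)) ∈ Ksub a := by
  induction hf using Submodule.span_induction with
  | mem f hf =>
    obtain ⟨π, rfl⟩ := hf
    refine Submodule.subset_span ⟨π, permPtn σ π, (ptype_permPtn σ π a h).symm, ?_⟩
    ext w
    simp [eSP_permPtn]
  | zero =>
    convert Submodule.zero_mem (Ksub a) using 1
    exact sub_self _
  | add f g _ _ hf hg =>
    convert Submodule.add_mem _ hf hg using 1
    ext w
    simp only [Pi.sub_apply, Pi.add_apply]
    ring
  | smul c f _ hf =>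
    convert Submodule.smul_mem _ c hf using 1
    ext w
    simp only [Pi.sub_apply, Pi.smul_apply, smul_sub]

lemma apply_eq_of_ker_eq {f : Md d} (hf : f ∈ elemSpan d) {w w' : NCWord d}
    (h : ∀ j k, w j = w k ↔ w' j = w' k) : f w = f w' := by
  induction hf using Submodule.span_induction with
  | mem f hf =>
    obtain ⟨π, rfl⟩ := hf
    refine if_congr ?_ rfl rfl
    simp only [ne_eq, h]
  | zero => rfl
  | add f g _ _ hf hg => rw [Pi.add_apply, Pi.add_apply, hf, hg]
  | smul c f _ hf => rw [Pi.smul_apply, Pi.smul_apply, hf]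

/-- The permutations fixing `a`. -/
def rootStab (a : Fin d) : Finset (Equiv.Perm (Fin d)) := Finset.univ.filter fun σ => σ a = a

/-- An element of the span whose symmetrization vanishes lies in `Ksub`. -/
lemma mem_Ksub_of_sum_eq_zero {f : Md d} (hf : f ∈ elemSpan d) (a : Fin d)
    (h : ∀ w, ∑ σ ∈ rootStab a, f (w ∘ σ) = 0) : f ∈ Ksub a := by
  have hsum : ∑ σ ∈ rootStab a, (f - fun w => f (w ∘ σ)) = ((rootStab a).card : ℚ) • f := by
    ext w
    simp only [Finset.sum_apply, Pi.sub_apply, Finset.sum_sub_distrib, h, Finset.sum_const,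
      sub_zero, Pi.smul_apply, nsmul_eq_mul, smul_eq_mul]
  have hmem : ((rootStab a).card : ℚ) • f ∈ Ksub a := by
    rw [← hsum]
    exact Submodule.sum_mem _ fun σ hσ => sub_comp_perm_mem_Ksub hf (Finset.mem_filter.1 hσ).2
  refine (Submodule.smul_mem_iff _ (Nat.cast_ne_zero.2 ?_)).1 hmem
  exact Finset.card_ne_zero_of_mem (a := 1) (by simp [rootStab])

/-- The letter attached to a colour. -/
def letter (i : Fin d) : ℕ+ := (i : ℕ).succPNat

lemma letter_injective : Function.Injective (letter (d := d)) :=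
  Nat.succPNat_injective.comp Fin.val_injective

/-- Replacing noncommuting by commuting variables while remembering the letter at `a`. -/
def rootedSeries (a : Fin d) : Md d →ₗ[ℚ] (Fin d → MvPolynomial (Fin d) ℚ) where
  toFun f r := ∑ κ : Fin d → Fin d,
    if κ a = r then f (letter ∘ κ) • ∏ v, MvPolynomial.X (κ v) else 0
  map_add' f g := by
    ext1 r
    simp only [Pi.add_apply, ← Finset.sum_add_distrib]
    refine Finset.sum_congr rfl fun κ _ => ?_
    split_ifs
    · rw [add_smul]
    · rw [add_zero]
  map_smul' c f := by
    ext1 r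
    simp only [Pi.smul_apply, Finset.smul_sum, RingHom.id_apply]
    refine Finset.sum_congr rfl fun κ _ => ?_
    split_ifs
    · rw [smul_assoc]
    · rw [smul_zero]

lemma rootedSeries_apply (a : Fin d) (f : Md d) (r : Fin d) :
    rootedSeries a f r = ∑ κ : Fin d → Fin d,
      if κ a = r then f (letter ∘ κ) • ∏ v, MvPolynomial.X (κ v) else 0 := rfl

/-- The exponent vector of a colouring. -/
def content (κ : Fin d → Fin d) : Fin d →₀ ℕ := ∑ v, Finsupp.single (κ v) 1

lemma content_apply (κ : Fin d → Fin d) (c : Fin d) :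
    content κ c = Fintype.card {v // κ v = c} := by
  simp [content, Finsupp.single_apply, Fintype.card_subtype]

lemma content_comp_perm (κ : Fin d → Fin d) (σ : Equiv.Perm (Fin d)) :
    content (κ ∘ σ) = content κ :=
  Equiv.sum_comp σ fun v => Finsupp.single (κ v) 1

/-- The colourings with the same content and the same colour at the root as `κ₀`. -/
def rootedOrbit (a : Fin d) (κ₀ : Fin d → Fin d) : Finset (Fin d → Fin d) :=
  Finset.univ.filter fun κ => κ a = κ₀ a ∧ content κ = content κ₀

lemma exists_perm_of_mem_rootedOrbit {a : Fin d} {κ₀ κ : Fin d → Fin d}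
    (h : κ ∈ rootedOrbit a κ₀) : ∃ ρ ∈ rootStab a, κ = κ₀ ∘ ρ := by
  obtain ⟨ha, hc⟩ := (Finset.mem_filter.1 h).2
  have hcard (c : Fin d) : Nonempty ({v // κ v = c} ≃ {v // κ₀ v = c}) := by
    rw [← Fintype.card_eq, ← content_apply, ← content_apply, hc]
  let ρ : Equiv.Perm (Fin d) := Equiv.ofFiberEquiv fun c => (hcard c).some
  have hρ (v : Fin d) : κ₀ (ρ v) = κ v := Equiv.ofFiberEquiv_map _ v
  refine ⟨Equiv.swap a (ρ a) * ρ, by simp [rootStab], ?_⟩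
  ext1 v
  rw [Function.comp_apply, Equiv.Perm.mul_apply, ← hρ, Equiv.swap_apply_def]
  split_ifs with h1 h2
  · rw [h1, hρ a, ha]
  · rw [h2, hρ a, ha]
  · rfl

lemma coeff_rootedSeries (a : Fin d) (f : Md d) (κ₀ : Fin d → Fin d) :
    (rootedSeries a f (κ₀ a)).coeff (content κ₀) =
      ∑ κ ∈ rootedOrbit a κ₀, f (letter ∘ κ) := by
  rw [rootedSeries_apply, MvPolynomial.coeff_sum, rootedOrbit, Finset.sum_filter]
  refine Finset.sum_congr rfl fun κ _ => ?_
  have hmon : ∏ v, (MvPolynomial.X (κ v) : MvPolynomial (Fin d) ℚ) =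
      MvPolynomial.monomial (content κ) 1 := by
    rw [content, MvPolynomial.monomial_sum_one]
    rfl
  rw [hmon]
  by_cases h : κ a = κ₀ a
  · rw [if_pos h, MvPolynomial.coeff_smul, MvPolynomial.coeff_monomial, smul_eq_mul, mul_ite,
      mul_one, mul_zero]
    simp only [h, true_and]
  · rw [if_neg h, if_neg fun h' => h h'.1, MvPolynomial.coeff_zero]

lemma comp_perm_mem_rootedOrbit {a : Fin d} {κ₀ κ : Fin d → Fin d} {σ : Equiv.Perm (Fin d)}
    (hσ : σ ∈ rootStab a) : κ ∘ σ ∈ rootedOrbit a κ₀ ↔ κ ∈ rootedOrbit a κ₀ := by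
  have h : σ a = a := (Finset.mem_filter.1 hσ).2
  simp [rootedOrbit, content_comp_perm, h]

lemma sum_rootStab_comp (a : Fin d) (f : Md d) (w : NCWord d) {ρ : Equiv.Perm (Fin d)}
    (hρ : ρ ∈ rootStab a) :
    ∑ σ ∈ rootStab a, f ((w ∘ ρ) ∘ σ) = ∑ σ ∈ rootStab a, f (w ∘ σ) := by
  have h : ρ a = a := (Finset.mem_filter.1 hρ).2
  refine Finset.sum_equiv (Equiv.mulLeft ρ) (fun σ => ?_) fun σ _ => rfl
  simp only [rootStab, Finset.mem_filter, Finset.mem_univ, true_and, Equiv.coe_mulLeft,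
    Equiv.Perm.mul_apply]
  rw [← ρ.injective.eq_iff, h]

lemma sum_rootStab_letter_eq_zero {a : Fin d} {f : Md d} (hf : rootedSeries a f = 0)
    (κ₀ : Fin d → Fin d) : ∑ σ ∈ rootStab a, f ((letter ∘ κ₀) ∘ σ) = 0 := by
  have horb : ∑ κ ∈ rootedOrbit a κ₀, f (letter ∘ κ) = 0 := by
    rw [← coeff_rootedSeries, hf, Pi.zero_apply, MvPolynomial.coeff_zero]
  have hdouble : ∑ κ ∈ rootedOrbit a κ₀, ∑ σ ∈ rootStab a, f ((letter ∘ κ) ∘ σ) = 0 := by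
    rw [Finset.sum_comm]
    refine Finset.sum_eq_zero fun σ hσ => ?_
    rw [← horb]
    exact Finset.sum_equiv (σ.symm.arrowCongr (Equiv.refl _))
      (fun κ => (comp_perm_mem_rootedOrbit hσ).symm) fun κ _ => rfl
  rw [Finset.sum_congr rfl (g := fun _ => ∑ σ ∈ rootStab a, f ((letter ∘ κ₀) ∘ σ)),
    Finset.sum_const, nsmul_eq_mul] at hdouble
  · refine (mul_eq_zero.1 hdouble).resolve_left (Nat.cast_ne_zero.2 ?_)
    exact Finset.card_ne_zero_of_mem (a := κ₀) (by simp [rootedOrbit])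
  · intro κ hκ
    obtain ⟨ρ, hρ, rfl⟩ := exists_perm_of_mem_rootedOrbit hκ
    exact sum_rootStab_comp a f (letter ∘ κ₀) hρ

/-- The kernel of `rootedSeries` on the span is contained in `Ksub`. -/
theorem mem_Ksub_of_rootedSeries_eq_zero {a : Fin d} {f : Md d} (hf : f ∈ elemSpan d)
    (h : rootedSeries a f = 0) : f ∈ Ksub a := by
  refine mem_Ksub_of_sum_eq_zero hf a fun w => ?_
  have : Nonempty (Fin d) := ⟨a⟩
  have hinv (v : Fin d) : w (Function.invFun w (w v)) = w v :=
    Function.invFun_eq ⟨v, rfl⟩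
  have hker (j k : Fin d) : w j = w k ↔
      letter (Function.invFun w (w j)) = letter (Function.invFun w (w k)) := by
    rw [letter_injective.eq_iff]
    exact ⟨congrArg _, fun h => by rw [← hinv j, h, hinv]⟩
  rw [← sum_rootStab_letter_eq_zero h fun v => Function.invFun w (w v)]
  exact Finset.sum_congr rfl fun σ _ => apply_eq_of_ker_eq hf fun j k => hker _ _

end Symmetrization

/-! ### Positivity -/

section Positivity

variable {d : ℕ}

lemma rootedSeries_eSP_ofSetoid (a : Fin d) (s : Setoid (Fin d)) :
    rootedSeries a (eSP (Finpartition.ofSetoid s)) = setoidSum MvPolynomial.X s a := by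
  ext1 r
  refine Finset.sum_congr rfl fun κ _ => ?_
  have hp : SetoidProper s (letter ∘ κ) ↔ SetoidProper s κ := by
    simp only [SetoidProper, Function.comp_apply, letter_injective.ne_iff]
  rw [eSP_ofSetoid, ite_and]
  simp only [hp, ite_smul, one_smul, zero_smul]

lemma exists_of_mem_setoidCone {a : Fin d} {g : Fin d → MvPolynomial (Fin d) ℚ}
    (hg : g ∈ setoidCone MvPolynomial.X a) :
    ∃ c : SetPtn d → ℚ, (∀ π, 0 ≤ c π) ∧ g = rootedSeries a (∑ π, c π • eSP π) := by
  induction hg using AddSubmonoid.closure_induction with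
  | mem g hg =>
    obtain ⟨c, hc, s, rfl⟩ := hg
    refine ⟨Pi.single (Finpartition.ofSetoid s) c, Pi.single_nonneg.2 hc, ?_⟩
    rw [← rootedSeries_eSP_ofSetoid, ← map_smul, Finset.sum_eq_single (Finpartition.ofSetoid s)]
    · rw [Pi.single_eq_same]
    · intro π _ hπ
      rw [Pi.single_eq_of_ne hπ, zero_smul]
    · simp
  | zero => exact ⟨0, fun _ => le_rfl, by simp⟩
  | add g₁ g₂ _ _ h₁ h₂ =>
    obtain ⟨c₁, hc₁, rfl⟩ := h₁
    obtain ⟨c₂, hc₂, rfl⟩ := h₂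
    refine ⟨c₁ + c₂, fun π => add_nonneg (hc₁ π) (hc₂ π), ?_⟩
    rw [← map_add, ← Finset.sum_add_distrib]
    simp only [Pi.add_apply, add_smul]

/-- A graph whose rooted series lies in the cone is positive. -/
theorem isEPosNCAt_of_mem_setoidCone {G : SimpleGraph (Fin d)} {a : Fin d}
    (h : rootedSeries a (YG G) ∈ setoidCone MvPolynomial.X a) : IsEPosNCAt G a := by
  obtain ⟨c, hc, hG⟩ := exists_of_mem_setoidCone h
  refine ⟨Finset.univ, c, hc, mem_Ksub_of_rootedSeries_eq_zero ?_ ?_⟩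
  · exact Submodule.sub_mem _ (YG_mem_elemSpan G) (Submodule.sum_mem _ fun π _ =>
      Submodule.smul_mem _ _ (Submodule.subset_span ⟨π, rfl⟩))
  · rw [map_sub, hG, sub_self]

end Positivity

lemma rootedSeries_YG_WLgraph (s n k : ℕ) (a : Fin (s + 2 + n)) (ha : (a : ℕ) = s + 1 + n)
    (r : Fin (s + 2 + n)) :
    rootedSeries a (YG (WLgraph (s + 2) n k)) r =
      wlSum MvPolynomial.X s k n fun i j => ladderTail MvPolynomial.X 0 i j r := by
  have hlt : s + 1 + n < s + 2 + n := by omega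
  obtain rfl : a = ⟨s + 1 + n, hlt⟩ := Fin.ext ha
  refine Finset.sum_congr rfl fun κ _ => ?_
  have hp : (∀ j l, (WLgraph (s + 2) n k).Adj j l → (letter ∘ κ) j ≠ (letter ∘ κ) l) ↔
      WLProper (s + 2) k κ := by
    rw [← wlGraph_proper_iff]
    simp only [Function.comp_apply, letter_injective.ne_iff]
  rw [YG, if_congr hp rfl rfl]
  by_cases h : WLProper (s + 2) k κ
  · rw [if_pos h, if_pos h, one_smul]
    simp only [ladderTail, mul_ite, mul_one, mul_zero, eq_comm]
  · rw [if_neg h, if_neg h, zero_smul, ite_self]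

theorem stmt8 (m n k : ℕ) (hm : 4 ≤ m) (hk1 : 1 ≤ k) (hk2 : k ≤ m - 2) :
    IsEPosNCAt (WLgraph m n k) (⟨m + n - 1, by omega⟩ : Fin (m + n)) := by
  obtain ⟨k, rfl⟩ := Nat.exists_eq_add_of_le' hk1
  obtain ⟨u, rfl⟩ : ∃ u, m = k + 1 + u + 2 := ⟨m - 2 - (k + 1), by omega⟩
  refine isEPosNCAt_of_mem_setoidCone ?_
  rw [funext (rootedSeries_YG_WLgraph (k + 1 + u) n (k + 1) _ (by simp))]
  exact (cliqueCone_wlSum MvPolynomial.X k u n).mem_setoidCone _ _ _ (Fintype.card_fin _)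
end
end

section
/- Let d ≥ 1, let λ be an integer partition and b ≥ 1 an integer with |λ| + b = d. Let π be a set partition of {1,…,d} of type (λ, b), let π₁ be a set partition of {1,…,d+1} of type (λ∪(b), 1), and let π₂ be a set partition of {1,…,d+1} of type (λ, b+1), where λ∪(b) denotes the partition obtained by adjoining a part equal to b to λ. Then b·(e_π↑) − e_{π₁} + e_{π₂} ∈ K_{d+1}; equivalently, modulo K_{d+1} one has e_π↑ = (1/b)·e_{π₁} − (1/b)·e_{π₂}. -/
open scoped Classical
noncomputable section

/-- Indicator of the words that are injective on every class of `s`. -/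
def properInd {V : Type*} (s : Setoid V) : (V → ℕ+) → ℚ :=
  fun w => if ∀ j k : V, j ≠ k → s j k → w j ≠ w k then 1 else 0

/-- Indicator of the words that are constant on every class of `s`. -/
def constInd {V : Type*} (s : Setoid V) : (V → ℕ+) → ℚ :=
  fun w => if s ≤ Setoid.ker w then 1 else 0

/-- Indicator of the words whose letters at `x` and `y` agree. -/
def eqInd {V : Type*} (x y : V) : (V → ℕ+) → ℚ :=
  fun w => if w x = w y then 1 else 0

/-- The equivalence relation agreeing with `s` on `T` and discrete outside `T`. -/
def restrictTo {V : Type*} (s : Setoid V) (T : Finset V) : Setoid V where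
  r i j := i = j ∨ (i ∈ T ∧ j ∈ T ∧ s i j)
  iseqv :=
    { refl := fun _ => Or.inl rfl
      symm := by
        rintro i j (rfl | ⟨hi, hj, h⟩)
        · exact Or.inl rfl
        · exact Or.inr ⟨hj, hi, s.symm h⟩
      trans := by
        rintro i j k (rfl | ⟨hi, hj, h⟩) (rfl | ⟨hj', hk, h'⟩)
        · exact Or.inl rfl
        · exact Or.inr ⟨hj', hk, h'⟩
        · exact Or.inr ⟨hi, hj, h⟩
        · exact Or.inr ⟨hi, hk, s.trans h h'⟩ }

theorem restrictTo_apply {V : Type*} (s : Setoid V) (T : Finset V) (i j : V) :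
    restrictTo s T i j ↔ i = j ∨ (i ∈ T ∧ j ∈ T ∧ s i j) := Iff.rfl

theorem restrictTo_mono {V : Type*} (s : Setoid V) {T U : Finset V} (h : T ⊆ U) :
    restrictTo s T ≤ restrictTo s U := by
  rintro i j (rfl | ⟨hi, hj, hij⟩)
  · exact Or.inl rfl
  · exact Or.inr ⟨h hi, h hj, hij⟩

theorem restrictTo_univ {V : Type*} [Fintype V] (s : Setoid V) :
    restrictTo s Finset.univ = s := by
  ext i j
  simp only [restrictTo_apply, Finset.mem_univ, true_and]
  exact ⟨fun h => h.elim (fun h => h ▸ s.refl i) id, Or.inr⟩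

theorem restrictTo_isolated {V : Type*} (s : Setoid V) {T : Finset V} {k : V} (hk : k ∉ T)
    (i : V) (h : restrictTo s T k i) : i = k := by
  rcases h with rfl | ⟨h, -⟩
  · rfl
  · exact absurd h hk

theorem properInd_restrictTo_insert {V : Type*} [DecidableEq V] (s : Setoid V) {T : Finset V} {k : V}
    (hk : k ∉ T) :
    properInd (restrictTo s (insert k T)) = properInd (restrictTo s T) -
      ∑ y ∈ T with s y k, eqInd y k * properInd (restrictTo s T) := by
  ext w
  simp only [Pi.sub_apply, Finset.sum_apply, Pi.mul_apply]
  by_cases h : ∀ i j : V, i ≠ j → restrictTo s T i j → w i ≠ w j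
  · have h1 : properInd (restrictTo s T) w = 1 := if_pos h
    simp only [h1, mul_one]
    by_cases hy : ∃ y ∈ T, s y k ∧ w y = w k
    · obtain ⟨y, hyT, hyk, hw⟩ := hy
      have hne : y ≠ k := fun e => hk (e ▸ hyT)
      have h0 : properInd (restrictTo s (insert k T)) w = 0 := by
        refine if_neg fun hall => hall y k hne (Or.inr ⟨?_, ?_, hyk⟩) hw
        · exact Finset.mem_insert_of_mem hyT
        · exact Finset.mem_insert_self _ _
      rw [h0, Finset.sum_eq_single_of_mem y (by simp [hyT, hyk])]
      · simp [eqInd, hw]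
      · intro z hz hzy
        simp only [Finset.mem_filter] at hz
        refine if_neg fun hzk => h z y hzy (Or.inr ⟨hz.1, hyT, ?_⟩) (hzk.trans hw.symm)
        exact s.trans hz.2 (s.symm hyk)
    · push Not at hy
      have h0 : properInd (restrictTo s (insert k T)) w = 1 := by
        refine if_pos ?_
        rintro i j hij (rfl | ⟨hi, hj, hs⟩)
        · exact absurd rfl hij
        · rcases Finset.mem_insert.1 hi with rfl | hiT
          · rcases Finset.mem_insert.1 hj with rfl | hj
            · exact absurd rfl hij
            · exact (hy j hj (s.symm hs)).symm
          · rcases Finset.mem_insert.1 hj with rfl | hj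
            · exact hy i hiT hs
            · exact h i j hij (Or.inr ⟨hiT, hj, hs⟩)
      rw [h0, Finset.sum_eq_zero, sub_zero]
      intro z hz
      simp only [Finset.mem_filter] at hz
      exact if_neg (hy z hz.1 hz.2)
  · have h1 : properInd (restrictTo s T) w = 0 := if_neg h
    have h0 : properInd (restrictTo s (insert k T)) w = 0 :=
      if_neg fun hall => h fun i j hij hs =>
        hall i j hij (restrictTo_mono s (Finset.subset_insert k T) hs)
    simp [h0, h1]

/-- The equivalence relation obtained from `t` by moving `k` into the class of `y`. -/
def attach {V : Type*} (t : Setoid V) (k y : V) : Setoid V :=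
  t.comap (Function.update id k y)

theorem attach_apply {V : Type*} (t : Setoid V) (k y i j : V) :
    attach t k y i j ↔ t (if i = k then y else i) (if j = k then y else j) := by
  rw [attach, Setoid.comap_rel, Function.update_apply, Function.update_apply, id, id]

theorem eqInd_mul_constInd {V : Type*} {t : Setoid V} {k : V} (y : V)
    (hk : ∀ i, t k i → i = k) :
    eqInd y k * constInd t = constInd (attach t k y) := by
  ext w
  have key : attach t k y ≤ Setoid.ker w ↔ w y = w k ∧ t ≤ Setoid.ker w := by
    constructor
    · intro h
      refine ⟨?_, fun i j hij => ?_⟩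
      · refine @h y k ?_
        rw [attach_apply]
        simp
      · by_cases hi : i = k
        · subst hi
          rw [hk j hij]
        by_cases hj : j = k
        · subst hj
          rw [hk i (t.symm hij)]
        refine @h i j ?_
        rwa [attach_apply, if_neg hi, if_neg hj]
    · rintro ⟨hw, h⟩ i j hij
      have hij' := h ((attach_apply t k y i j).1 hij)
      simp only [Setoid.ker_def] at hij' ⊢
      split_ifs at hij' <;> simp_all
  by_cases h1 : w y = w k <;> by_cases h2 : t ≤ Setoid.ker w <;>
    simp [eqInd, constInd, key, h1, h2]

theorem attach_lt_attach {V : Type*} {t s : Setoid V} {k : V} (y : V)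
    (hk : ∀ i, s k i → i = k) (h : t < s) : attach t k y < attach s k y := by
  refine lt_of_le_not_ge (fun i j hij => ?_) fun hle => h.not_ge fun i j hij => ?_
  · rw [attach_apply] at hij ⊢
    exact h.le hij
  · by_cases hi : i = k
    · subst hi
      rw [hk j hij]
    by_cases hj : j = k
    · subst hj
      rw [hk i (s.symm hij)]
    have := @hle i j (by rwa [attach_apply, if_neg hi, if_neg hj])
    rwa [attach_apply, if_neg hi, if_neg hj] at this

theorem attach_restrictTo {V : Type*} (s : Setoid V) {T : Finset V} {k y : V} (hk : k ∉ T)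
    (hy : y ∈ T) (hyk : s y k) : attach (restrictTo s T) k y = restrictTo s (insert k T) := by
  ext i j
  rw [attach_apply, restrictTo_apply, restrictTo_apply]
  have hky := s.symm hyk
  by_cases hi : i = k <;> by_cases hj : j = k
  · subst hi; subst hj; simp
  · subst hi
    rw [if_pos rfl, if_neg hj]
    simp only [Finset.mem_insert, hj, true_or, false_or, true_and, hy]
    constructor
    · rintro (rfl | ⟨h, h'⟩)
      · exact Or.inr ⟨hy, hky⟩
      · exact Or.inr ⟨h, s.trans hky h'⟩
    · rintro (rfl | ⟨h, h'⟩)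
      · exact absurd rfl hj
      · exact Or.inr ⟨h, s.trans hyk h'⟩
  · subst hj
    rw [if_pos rfl, if_neg hi]
    simp only [Finset.mem_insert, hi, true_or, false_or, true_and, hy]
    constructor
    · rintro (rfl | ⟨h, h'⟩)
      · exact ⟨hy, hyk⟩
      · exact ⟨h, s.trans h' hyk⟩
    · rintro ⟨h, h'⟩
      exact Or.inr ⟨h, s.trans h' hky⟩
  · simp [hi, hj]

theorem eqInd_mul_mem_span {V : Type*} {s : Setoid V} {k : V} (y : V)
    (hk : ∀ i, s k i → i = k) {f : (V → ℕ+) → ℚ}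
    (hf : f ∈ Submodule.span ℚ (constInd '' Set.Iio s)) :
    eqInd y k * f ∈ Submodule.span ℚ (constInd '' Set.Iio (attach s k y)) := by
  have h : Submodule.span ℚ (constInd '' Set.Iio s) ≤
      (Submodule.span ℚ (constInd '' Set.Iio (attach s k y))).comap
        (LinearMap.mulLeft ℚ (eqInd y k)) := by
    rw [Submodule.span_le]
    rintro _ ⟨t, ht, rfl⟩
    refine Submodule.subset_span ⟨attach t k y, attach_lt_attach y hk ht, ?_⟩
    exact (eqInd_mul_constInd y fun i hi => hk i ((Set.mem_Iio.1 ht).le hi)).symm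
  exact h hf

/-- `properInd` is triangular with nonzero diagonal with respect to `constInd`. -/
theorem exists_properInd_restrictTo_sub_mem {V : Type*} (s : Setoid V) (T : Finset V) :
    ∃ c : ℚ, c ≠ 0 ∧ properInd (restrictTo s T) - c • constInd (restrictTo s T) ∈
      Submodule.span ℚ (constInd '' Set.Iio (restrictTo s T)) := by
  induction T using Finset.induction_on with
  | empty =>
    refine ⟨1, one_ne_zero, ?_⟩
    have : properInd (restrictTo s ∅) - (1 : ℚ) • constInd (restrictTo s ∅) = 0 := by
      have h1 : ∀ i j, restrictTo s ∅ i j ↔ i = j := by simp [restrictTo_apply]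
      ext w
      have h2 : restrictTo s ∅ ≤ Setoid.ker w := by
        intro i j hij
        rw [(h1 i j).1 hij]
      have h3 : ∀ i j : V, i ≠ j → restrictTo s ∅ i j → w i ≠ w j :=
        fun i j hij h => absurd ((h1 i j).1 h) hij
      simp only [Pi.sub_apply, Pi.smul_apply, properInd, constInd, if_pos h2, if_pos h3]
      simp
    rw [this]
    exact zero_mem _
  | insert k T hk ih =>
    obtain ⟨c, hc, hr⟩ := ih
    by_cases hY : (T.filter fun y => s y k).Nonempty
    · refine ⟨-((T.filter fun y => s y k).card * c), ?_, ?_⟩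
      · exact neg_ne_zero.2 (mul_ne_zero (by exact_mod_cast hY.card_ne_zero) hc)
      set D := properInd (restrictTo s T) with hD
      set P := constInd (restrictTo s T) with hP
      set P' := constInd (restrictTo s (insert k T)) with hP'
      have hiso := restrictTo_isolated s hk
      have hatt : ∀ y ∈ T.filter (fun y => s y k),
          attach (restrictTo s T) k y = restrictTo s (insert k T) := fun y hy => by
        rw [Finset.mem_filter] at hy
        exact attach_restrictTo s hk hy.1 hy.2
      have hsum : ∑ y ∈ T with s y k, eqInd y k * D =
          ((T.filter fun y => s y k).card * c) • P' +
            ∑ y ∈ T with s y k, eqInd y k * (D - c • P) := by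
        have : ∀ y ∈ T.filter (fun y => s y k),
            eqInd y k * D = c • P' + eqInd y k * (D - c • P) := fun y hy => by
          rw [mul_sub, mul_smul_comm, hP, eqInd_mul_constInd y hiso, hatt y hy]
          abel
        rw [Finset.sum_congr rfl this, Finset.sum_add_distrib, Finset.sum_const, mul_smul,
          Nat.cast_smul_eq_nsmul]
      have hlt : restrictTo s T < restrictTo s (insert k T) := by
        refine lt_of_le_not_ge (restrictTo_mono s (Finset.subset_insert k T)) fun h => ?_
        obtain ⟨y, hy⟩ := hY
        rw [Finset.mem_filter] at hy
        have hky : restrictTo s (insert k T) k y :=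
          Or.inr ⟨Finset.mem_insert_self _ _, Finset.mem_insert_of_mem hy.1, s.symm hy.2⟩
        exact hk (hiso y (h hky) ▸ hy.1)
      rw [properInd_restrictTo_insert s hk, ← hD, hsum]
      have heq : D - (((T.filter fun y => s y k).card * c) • P' +
            ∑ y ∈ T with s y k, eqInd y k * (D - c • P)) -
            (-((T.filter fun y => s y k).card * c)) • P' =
          (D - c • P) + c • P - ∑ y ∈ T with s y k, eqInd y k * (D - c • P) := by
        rw [neg_smul]
        abel
      rw [heq]
      refine sub_mem (add_mem ?_ (Submodule.smul_mem _ _ ?_)) (Submodule.sum_mem _ fun y hy => ?_)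
      · exact Submodule.span_mono (Set.image_mono (Set.Iio_subset_Iio hlt.le)) hr
      · exact Submodule.subset_span ⟨_, hlt, rfl⟩
      · have := eqInd_mul_mem_span y hiso hr
        rwa [hatt y hy] at this
    · have he : restrictTo s (insert k T) = restrictTo s T := by
        refine le_antisymm ?_ (restrictTo_mono s (Finset.subset_insert k T))
        rw [Finset.not_nonempty_iff_eq_empty, Finset.filter_eq_empty_iff] at hY
        rintro i j (rfl | ⟨hi, hj, hs⟩)
        · exact Or.inl rfl
        · rcases Finset.mem_insert.1 hi with rfl | hiT
          · rcases Finset.mem_insert.1 hj with rfl | hj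
            · exact Or.inl rfl
            · exact absurd (s.symm hs) (hY hj)
          · rcases Finset.mem_insert.1 hj with rfl | hj
            · exact absurd hs (hY hiT)
            · exact Or.inr ⟨hiT, hj, hs⟩
      rw [he]
      exact ⟨c, hc, hr⟩

theorem exists_properInd_sub_mem {V : Type*} [Fintype V] (s : Setoid V) :
    ∃ c : ℚ, c ≠ 0 ∧ properInd s - c • constInd s ∈
      Submodule.span ℚ (constInd '' Set.Iio s) := by
  simpa only [restrictTo_univ] using exists_properInd_restrictTo_sub_mem s Finset.univ

theorem constInd_mem_span_properInd {V : Type*} [Finite V] (s : Setoid V) :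
    constInd s ∈ Submodule.span ℚ (Set.range (properInd (V := V))) := by
  have := Fintype.ofFinite V
  have : Finite (Setoid V) :=
    Finite.of_injective (fun t : Setoid V => (t : V → V → Prop)) 
      fun a b h => Setoid.ext fun i j => iff_of_eq (congrFun (congrFun h i) j)
  induction s using WellFoundedLT.induction with
  | ind s ih =>
    obtain ⟨c, hc, h⟩ := exists_properInd_sub_mem s
    have hle : Submodule.span ℚ (constInd '' Set.Iio s) ≤
        Submodule.span ℚ (Set.range (properInd (V := V))) := by
      rw [Submodule.span_le]
      rintro _ ⟨t, ht, rfl⟩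
      exact ih t ht
    have h' : c • constInd s ∈ Submodule.span ℚ (Set.range (properInd (V := V))) := by
      have := sub_mem (Submodule.subset_span (Set.mem_range_self s)) (hle h)
      rwa [sub_sub_cancel] at this
    simpa [smul_smul, inv_mul_cancel₀ hc] using Submodule.smul_mem _ c⁻¹ h'

theorem eqInd_mul_properInd_mem_span {V : Type*} [Finite V] {s : Setoid V} {k : V} (y : V)
    (hk : ∀ i, s k i → i = k) :
    eqInd y k * properInd s ∈ Submodule.span ℚ (Set.range (properInd (V := V))) := by
  have := Fintype.ofFinite V
  obtain ⟨c, -, h⟩ := exists_properInd_sub_mem s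
  have hle : Submodule.span ℚ (constInd '' Set.Iio (attach s k y)) ≤
      Submodule.span ℚ (Set.range (properInd (V := V))) := by
    rw [Submodule.span_le]
    rintro _ ⟨t, -, rfl⟩
    exact constInd_mem_span_properInd t
  have h1 := hle (eqInd_mul_mem_span y hk h)
  have h2 := Submodule.smul_mem _ c (constInd_mem_span_properInd (attach s k y))
  rw [← eqInd_mul_constInd y hk] at h2
  have := add_mem h1 h2
  rwa [mul_sub, mul_smul_comm, sub_add_cancel] at this

/-- The equivalence relation of lying in a common block. -/
def blockSetoid {d : ℕ} (π : SetPtn d) : Setoid (Fin d) where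
  r := sameBlock π
  iseqv :=
    { refl := fun i => by
        obtain ⟨B, hB, hi⟩ := π.exists_mem (Finset.mem_univ i)
        exact ⟨B, hB, hi, hi⟩
      symm := fun ⟨B, hB, hi, hj⟩ => ⟨B, hB, hj, hi⟩
      trans := by
        rintro i j k ⟨B, hB, hi, hj⟩ ⟨C, hC, hj', hk⟩
        obtain rfl := π.eq_of_mem_parts hB hC hj hj'
        exact ⟨B, hB, hi, hk⟩ }

theorem eSP_eq_properInd {d : ℕ} (π : SetPtn d) : eSP π = properInd (blockSetoid π) := by
  ext w
  rw [eSP, properInd]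
  congr

theorem exists_blockSetoid_eq {d : ℕ} (s : Setoid (Fin d)) :
    ∃ π : SetPtn d, blockSetoid π = s := by
  refine ⟨Finpartition.ofSetoid s, Setoid.ext fun i j => ?_⟩
  refine Iff.trans ?_ Finpartition.mem_part_ofSetoid_iff_rel
  constructor
  · rintro ⟨B, hB, hi, hj⟩
    rwa [Finpartition.part_eq_of_mem _ hB hi]
  · intro h
    exact ⟨_, (Finpartition.part_mem _).2 (Finset.mem_univ i),
      Finpartition.mem_part _ (Finset.mem_univ i), h⟩

/-- The size of the class of `i`. -/
def classCard {V : Type*} [Fintype V] (s : Setoid V) (i : V) : ℕ :=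
  (Finset.univ.filter fun j => s i j).card

/-- The number of elements outside the class of `a` whose class has size `m`. -/
def outsideCount {V : Type*} [Fintype V] (s : Setoid V) (a : V) (m : ℕ) : ℕ :=
  (Finset.univ.filter fun i => ¬ s a i ∧ classCard s i = m).card

theorem ptype_snd {d : ℕ} (π : SetPtn d) (a : Fin d) :
    (ptype π a).2 = classCard (blockSetoid π) a := rfl

theorem blockOf_eq {d : ℕ} {π : SetPtn d} {B : Finset (Fin d)} (hB : B ∈ π.parts) {i : Fin d}
    (hi : i ∈ B) : blockOf π i = B := by
  ext j
  simp only [blockOf, Finset.mem_filter, Finset.mem_univ, true_and]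
  constructor
  · rintro ⟨C, hC, hi', hj⟩
    rwa [π.eq_of_mem_parts hB hC hi hi']
  · exact fun hj => ⟨B, hB, hi, hj⟩

theorem count_ptype_fst_mul {d : ℕ} (π : SetPtn d) (a : Fin d) (m : ℕ) :
    (ptype π a).1.count m * m = outsideCount (blockSetoid π) a m := by
  have hset : (Finset.univ.filter fun i => ¬ blockSetoid π a i ∧ classCard (blockSetoid π) i = m) =
      ((π.parts.erase (blockOf π a)).filter fun B => B.card = m).biUnion id := by
    ext i
    obtain ⟨B, hB, hi⟩ := π.exists_mem (Finset.mem_univ i)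
    have hcard : classCard (blockSetoid π) i = B.card := congrArg Finset.card (blockOf_eq hB hi)
    have hai : blockSetoid π a i ↔ B = blockOf π a := by
      constructor
      · rintro ⟨C, hC, ha, hi'⟩
        rw [blockOf_eq hC ha]
        exact π.eq_of_mem_parts hB hC hi hi'
      · intro h
        have : i ∈ blockOf π a := h ▸ hi
        exact (Finset.mem_filter.1 this).2
    simp only [Finset.mem_filter, Finset.mem_univ, true_and, Finset.mem_biUnion,
      Finset.mem_erase, id, hcard, hai]
    constructor
    · rintro ⟨h1, h2⟩
      exact ⟨B, ⟨⟨h1, hB⟩, h2⟩, hi⟩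
    · rintro ⟨C, ⟨⟨h1, hC⟩, h2⟩, hi'⟩
      obtain rfl := π.eq_of_mem_parts hB hC hi hi'
      exact ⟨h1, h2⟩
  rw [outsideCount, hset, Finset.card_biUnion]
  · simp only [id]
    rw [Finset.sum_const_nat fun B hB => (Finset.mem_filter.1 hB).2, ptype, Multiset.count_map,
      Finset.card_def, Finset.filter_val]
    simp only [eq_comm]
  · intro B hB C hC hBC
    have hB' := Finset.mem_of_mem_erase (Finset.mem_filter.1 hB).1
    have hC' := Finset.mem_of_mem_erase (Finset.mem_filter.1 hC).1
    exact π.disjoint hB' hC' hBC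

theorem ptype_fst_pos {d : ℕ} (π : SetPtn d) (a : Fin d) (m : ℕ) (hm : m ∈ (ptype π a).1) :
    0 < m := by
  simp only [ptype, Multiset.mem_map, Finset.mem_val, Finset.mem_erase] at hm
  obtain ⟨B, ⟨-, hB⟩, rfl⟩ := hm
  exact (π.nonempty_of_mem_parts hB).card_pos

theorem ptype_eq_of_counts {d : ℕ} (π : SetPtn d) (a : Fin d) {lam : Multiset ℕ} {b : ℕ}
    (hlam : ∀ x ∈ lam, 0 < x) (h1 : ∀ m, outsideCount (blockSetoid π) a m = lam.count m * m)
    (h2 : classCard (blockSetoid π) a = b) : ptype π a = (lam, b) := by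
  refine Prod.ext (Multiset.ext.2 fun m => ?_) h2
  rcases Nat.eq_zero_or_pos m with rfl | hm
  · rw [Multiset.count_eq_zero_of_notMem fun h => (ptype_fst_pos π a 0 h).false,
      Multiset.count_eq_zero_of_notMem fun h => (hlam 0 h).false]
  · exact Nat.eq_of_mul_eq_mul_right hm ((count_ptype_fst_mul π a m).trans (h1 m))

theorem properInd_sub_eSP_mem_Ksub {d : ℕ} {a : Fin d} (s : Setoid (Fin d)) (π : SetPtn d)
    (h1 : ∀ m, outsideCount s a m = (ptype π a).1.count m * m)
    (h2 : classCard s a = (ptype π a).2) : properInd s - eSP π ∈ Ksub a := by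
  obtain ⟨ρ, rfl⟩ := exists_blockSetoid_eq s
  exact Submodule.subset_span
    ⟨ρ, π, ptype_eq_of_counts ρ a (ptype_fst_pos π a) h1 h2, by rw [eSP_eq_properInd ρ]⟩

/-- Permuting the positions of a word. -/
def permute {V : Type*} (σ : Equiv.Perm V) : ((V → ℕ+) → ℚ) →ₗ[ℚ] ((V → ℕ+) → ℚ) :=
  LinearMap.funLeft ℚ ℚ fun w : V → ℕ+ => w ∘ σ

theorem permute_properInd {V : Type*} (σ : Equiv.Perm V) (s : Setoid V) :
    permute σ (properInd s) = properInd (s.comap σ.symm) := by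
  ext w
  simp only [permute, LinearMap.funLeft_apply, properInd]
  refine if_congr ⟨fun h i j hij hs => ?_, fun h i j hij hs => ?_⟩ rfl rfl
  · simpa using h (σ.symm i) (σ.symm j) (by simpa using hij) hs
  · exact h (σ i) (σ j) (by simpa using hij) (by simpa [Setoid.comap_rel] using hs)

theorem classCard_comap {V : Type*} [Fintype V] (σ : Equiv.Perm V) (s : Setoid V) (i : V) :
    classCard (s.comap σ) i = classCard s (σ i) :=
  Finset.card_equiv σ (by simp [Setoid.comap_rel])

theorem outsideCount_comap {V : Type*} [Fintype V] (σ : Equiv.Perm V) (s : Setoid V) (a : V)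
    (m : ℕ) : outsideCount (s.comap σ) a m = outsideCount s (σ a) m :=
  Finset.card_equiv σ (by simp [Setoid.comap_rel, classCard_comap])

theorem permute_sub_mem_Ksub {d : ℕ} {a : Fin d} {σ : Equiv.Perm (Fin d)} (hσ : σ a = a)
    {f : Md d} (hf : f ∈ Submodule.span ℚ (Set.range (properInd (V := Fin d)))) :
    permute σ f - f ∈ Ksub a := by
  have h : Submodule.span ℚ (Set.range (properInd (V := Fin d))) ≤
      (Ksub a).comap (permute σ - LinearMap.id) := by
    rw [Submodule.span_le]
    rintro _ ⟨s, rfl⟩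
    obtain ⟨π, rfl⟩ := exists_blockSetoid_eq s
    have ha : σ.symm a = a := by rw [Equiv.symm_apply_eq, hσ]
    change permute σ (properInd (blockSetoid π)) - properInd (blockSetoid π) ∈ Ksub a
    rw [permute_properInd, ← eSP_eq_properInd]
    refine properInd_sub_eSP_mem_Ksub _ π (fun m => ?_) ?_
    · rw [outsideCount_comap, ha, count_ptype_fst_mul]
    · rw [classCard_comap, ha, ptype_snd]
  exact h hf

theorem eqInd_mul_properInd_sub_mem_Ksub {d : ℕ} {a x y : Fin d} {s : Setoid (Fin d)}
    (ha : ∀ i, s a i → i = a) (hx : x ≠ a) (hy : y ≠ a) (hxy : s x y) :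
    eqInd y a * properInd s - eqInd x a * properInd s ∈ Ksub a := by
  have hσ : Equiv.swap x y a = a := Equiv.swap_apply_of_ne_of_ne hx.symm hy.symm
  have h := permute_sub_mem_Ksub hσ (eqInd_mul_properInd_mem_span x ha)
  have hs : s.comap (Equiv.swap x y).symm = s := by
    have key : ∀ i, s i (Equiv.swap x y i) := fun i => by
      rw [Equiv.swap_apply_def]
      split_ifs with h1 h2
      · exact h1 ▸ hxy
      · exact h2 ▸ s.symm hxy
      · exact s.refl i
    refine Setoid.ext fun i j => ?_
    rw [Equiv.symm_swap, Setoid.comap_rel]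
    exact ⟨fun h => s.trans (key i) (s.trans h (s.symm (key j))),
      fun h => s.trans (s.symm (key i)) (s.trans h (key j))⟩
  have hp : permute (Equiv.swap x y) (eqInd x a * properInd s) = eqInd y a * properInd s := by
    have h1 : permute (Equiv.swap x y) (eqInd x a * properInd s) =
        eqInd y a * permute (Equiv.swap x y) (properInd s) := by
      ext w
      simp [permute, LinearMap.funLeft_apply, eqInd, hσ]
    rw [h1, permute_properInd, hs]
  rwa [hp] at h

/-- The equivalence relation on `Fin (d + 1)` extending `s` with the last element equivalent
to `a`. -/
def extendLast {d : ℕ} (s : Setoid (Fin d)) (a : Fin d) : Setoid (Fin (d + 1)) :=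
  s.comap (Fin.lastCases a id)

section extendLast

variable {d : ℕ} (s : Setoid (Fin d)) (a : Fin d)

theorem extendLast_castSucc (i j : Fin d) :
    extendLast s a i.castSucc j.castSucc ↔ s i j := by
  rw [extendLast, Setoid.comap_rel, Fin.lastCases_castSucc, Fin.lastCases_castSucc, id, id]

theorem extendLast_last (j : Fin d) :
    extendLast s a (Fin.last d) j.castSucc ↔ s a j := by
  rw [extendLast, Setoid.comap_rel, Fin.lastCases_last, Fin.lastCases_castSucc, id]

/-- The equivalence relation on `Fin (d + 1)` extending `s` with the last element isolated. -/
def isolateLast : Setoid (Fin (d + 1)) :=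
  restrictTo (extendLast s a) (Finset.univ.erase (Fin.last d))

theorem isolateLast_castSucc (i j : Fin d) :
    isolateLast s a i.castSucc j.castSucc ↔ s i j := by
  rw [isolateLast, restrictTo_apply, extendLast_castSucc]
  simp only [Finset.mem_erase,
    Finset.mem_univ, and_true, ne_eq, Fin.castSucc_ne_last, not_false_eq_true, true_and,
    Fin.castSucc_inj, or_iff_right_iff_imp]
  rintro rfl
  exact s.refl i

theorem isolateLast_last (i : Fin (d + 1)) (h : isolateLast s a (Fin.last d) i) :
    i = Fin.last d :=
  restrictTo_isolated _ (Finset.notMem_erase _ _) i h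

theorem properInd_isolateLast (w : Fin (d + 1) → ℕ+) :
    properInd (isolateLast s a) w = properInd s fun i => w i.castSucc := by
  rw [properInd, properInd]
  congr 1
  refine propext ⟨fun h i j hij hs => ?_, fun h i j hij hs => ?_⟩
  · exact h _ _ (by simpa using hij) ((isolateLast_castSucc s a i j).2 hs)
  · induction i using Fin.lastCases with
    | last => exact absurd (isolateLast_last s a j hs).symm hij
    | cast i =>
      induction j using Fin.lastCases with
      | last => exact absurd (isolateLast_last s a _ ((isolateLast s a).symm hs)) hij
      | cast j => exact h i j (by simpa using hij) ((isolateLast_castSucc s a i j).1 hs)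

theorem card_filter_fin_succ {d : ℕ} (p : Fin (d + 1) → Prop) [DecidablePred p] :
    (Finset.univ.filter p).card =
      (Finset.univ.filter fun i : Fin d => p i.castSucc).card +
        if p (Fin.last d) then 1 else 0 := by
  simp only [Finset.card_filter, Fin.sum_univ_castSucc]

theorem classCard_isolateLast_castSucc (i : Fin d) :
    classCard (isolateLast s a) i.castSucc = classCard s i := by
  have h : ¬ isolateLast s a i.castSucc (Fin.last d) := fun h =>
    Fin.castSucc_ne_last i (isolateLast_last s a _ ((isolateLast s a).symm h))
  rw [classCard, card_filter_fin_succ, if_neg h, add_zero]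
  simp only [isolateLast_castSucc, classCard]

theorem not_isolateLast_last_castSucc (i : Fin d) :
    ¬ isolateLast s a (Fin.last d) i.castSucc := fun h =>
  Fin.castSucc_ne_last i (isolateLast_last s a _ h)

theorem classCard_isolateLast_last : classCard (isolateLast s a) (Fin.last d) = 1 := by
  rw [classCard, card_filter_fin_succ, if_pos ((isolateLast s a).refl _)]
  simp [not_isolateLast_last_castSucc]

theorem outsideCount_isolateLast (m : ℕ) :
    outsideCount (isolateLast s a) (Fin.last d) m =
      outsideCount s a m + if classCard s a = m then m else 0 := by
  rw [outsideCount, card_filter_fin_succ, if_neg fun h => h.1 ((isolateLast s a).refl _)]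
  simp only [not_isolateLast_last_castSucc, classCard_isolateLast_castSucc, not_false_eq_true,
    true_and, add_zero]
  have hcls : ∀ i, s a i → classCard s i = classCard s a := fun i hi => by
    refine congrArg Finset.card (Finset.filter_congr fun j _ => ?_)
    exact ⟨fun h => s.trans hi h, fun h => s.trans (s.symm hi) h⟩
  rw [← Finset.card_filter_add_card_filter_not (s := Finset.univ.filter fun i => classCard s i = m)
    (p := fun i => s a i), add_comm, Finset.filter_filter, Finset.filter_filter, outsideCount]
  congr 1
  · simp only [and_comm]
  · split_ifs with h
    · rw [← h]
      refine congrArg Finset.card (Finset.filter_congr fun j _ => ?_)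
      exact ⟨fun h => h.2, fun h => ⟨hcls j h, h⟩⟩
    · rw [Finset.card_eq_zero, Finset.filter_eq_empty_iff]
      rintro i - ⟨h1, h2⟩
      exact h ((hcls i h2).symm.trans h1)

theorem classCard_extendLast_last :
    classCard (extendLast s a) (Fin.last d) = classCard s a + 1 := by
  rw [classCard, card_filter_fin_succ, if_pos ((extendLast s a).refl _)]
  simp only [extendLast_last, classCard]

theorem outsideCount_extendLast (m : ℕ) :
    outsideCount (extendLast s a) (Fin.last d) m = outsideCount s a m := by
  rw [outsideCount, card_filter_fin_succ, if_neg fun h => h.1 ((extendLast s a).refl _), add_zero]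
  refine congrArg Finset.card (Finset.filter_congr fun i _ => ?_)
  rw [extendLast_last]
  refine and_congr_right fun h => ?_
  have h' : ¬ extendLast s a i.castSucc (Fin.last d) := fun hi =>
    h ((extendLast_last s a i).1 ((extendLast s a).symm hi))
  rw [classCard, card_filter_fin_succ, if_neg h', add_zero]
  simp only [extendLast_castSucc, classCard]

/-- Summing over the class of `a` the words in which the last letter repeats a given letter. -/
theorem sum_eqInd_mul_properInd_isolateLast :
    ∑ y : Fin d with s a y,
        eqInd y.castSucc (Fin.last d) * properInd (isolateLast s a) =
      properInd (isolateLast s a) - properInd (extendLast s a) := by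
  have h := properInd_restrictTo_insert (extendLast s a)
    (Finset.notMem_erase (Fin.last d) Finset.univ)
  rw [Finset.insert_erase (Finset.mem_univ _), restrictTo_univ] at h
  rw [h, ← isolateLast, sub_sub_cancel]
  refine Finset.sum_bij (fun y _ => y.castSucc) ?_ ?_ ?_ ?_
  · intro y hy
    simp only [Finset.mem_filter, Finset.mem_univ, true_and] at hy
    simp only [Finset.mem_filter, Finset.mem_erase, Finset.mem_univ, and_true]
    exact ⟨Fin.castSucc_ne_last y, (extendLast s a).symm ((extendLast_last s a y).2 hy)⟩
  · exact fun y _ z _ h => Fin.castSucc_injective _ h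
  · intro y hy
    simp only [Finset.mem_filter, Finset.mem_erase, Finset.mem_univ, and_true] at hy
    induction y using Fin.lastCases with
    | last => exact absurd rfl hy.1
    | cast y =>
      refine ⟨y, ?_, rfl⟩
      simpa using (extendLast_last s a y).1 ((extendLast s a).symm hy.2)
  · exact fun _ _ => rfl

end extendLast

theorem induct_eSP {d : ℕ} (hd : 0 < d) (π : SetPtn d) :
    induct (eSP π) = eqInd (Fin.castSucc ⟨d - 1, by omega⟩) (Fin.last d) *
      properInd (isolateLast (blockSetoid π) ⟨d - 1, by omega⟩) := by
  ext w
  rw [Pi.mul_apply, properInd_isolateLast, eSP_eq_properInd, induct, eqInd, ite_mul, one_mul,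
    zero_mul]
  exact if_congr eq_comm rfl rfl

theorem stmt9 (d : ℕ) (hd : 0 < d) (lam : Multiset ℕ) (hlam : ∀ x ∈ lam, 0 < x)
    (b : ℕ) (hb : 1 ≤ b) (hsum : lam.sum + b = d)
    (π : SetPtn d) (hπ : ptype π (⟨d - 1, by omega⟩ : Fin d) = (lam, b))
    (π₁ : SetPtn (d + 1)) (hπ₁ : ptype π₁ (Fin.last d) = (b ::ₘ lam, 1))
    (π₂ : SetPtn (d + 1)) (hπ₂ : ptype π₂ (Fin.last d) = (lam, b + 1)) :
    (b : ℚ) • induct (eSP π) - eSP π₁ + eSP π₂ ∈ Ksub (Fin.last d) := by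
  rw [induct_eSP hd]
  set a : Fin d := ⟨d - 1, by omega⟩
  set s := blockSetoid π
  have hout : ∀ m, outsideCount s a m = lam.count m * m := fun m => by
    rw [← count_ptype_fst_mul, hπ]
  have hcls : classCard s a = b := by rw [← ptype_snd, hπ]
  have h₁ : properInd (isolateLast s a) - eSP π₁ ∈ Ksub (Fin.last d) := by
    refine properInd_sub_eSP_mem_Ksub _ π₁ (fun m => ?_) ?_
    · rw [hπ₁, outsideCount_isolateLast, hout, hcls, Multiset.count_cons, add_mul, ite_mul,
        one_mul, zero_mul]
      simp only [eq_comm]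
    · rw [hπ₁, classCard_isolateLast_last]
  have h₂ : properInd (extendLast s a) - eSP π₂ ∈ Ksub (Fin.last d) := by
    refine properInd_sub_eSP_mem_Ksub _ π₂ (fun m => ?_) ?_
    · rw [hπ₂, outsideCount_extendLast, hout]
    · rw [hπ₂, classCard_extendLast_last, hcls]
  have h₃ : ∑ y : Fin d with s a y,
      (eqInd y.castSucc (Fin.last d) * properInd (isolateLast s a) -
        eqInd a.castSucc (Fin.last d) * properInd (isolateLast s a)) ∈ Ksub (Fin.last d) :=
    Submodule.sum_mem _ fun y hy => eqInd_mul_properInd_sub_mem_Ksub (isolateLast_last s a)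
      (Fin.castSucc_ne_last a) (Fin.castSucc_ne_last y)
      ((isolateLast_castSucc s a a y).2 (Finset.mem_filter.1 hy).2)
  rw [Finset.sum_sub_distrib, sum_eqInd_mul_properInd_isolateLast, Finset.sum_const,
    ← classCard, hcls, ← Nat.cast_smul_eq_nsmul ℚ] at h₃
  convert sub_mem (sub_mem h₁ h₂) h₃ using 1
  abel
end
end
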